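/- arXiv:2006.10542 — 2 statements merged into one kernel-verified Lean document; each statement's English description precedes it below -/
import Mathlib

section
/- Let n ≥ 2 and let F = α + β be a Randers metric on a nonempty open connected set U ⊆ ℝⁿ which is non-Riemannian (the 1-form β does not vanish identically on U) and conformally flat, i.e. F(x,y) = e^{κ(x)} F̄(y) for a smooth function κ : U → ℝ and a Minkowski norm F̄ on ℝⁿ. If F is of weakly isotropic scalar curvature, i.e. r(x,y) = n(n−1)(θ(x,y)/F(x,y) + μ(x)) for some smooth 1-form θ = θ_i(x)y^i and smooth function μ on U, then κ is constant on U; in particular F(x,y) is independent of x, i.e. F is a (locally) Minkowski metric. -/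
open MeasureTheory Matrix

noncomputable section

/-- `Vec n` is ℝⁿ. -/
abbrev Vec (n : ℕ) := Fin n → ℝ

/-- Partial derivative of `f` in the `i`-th coordinate direction at `x`. -/
noncomputable def pd {n : ℕ} (i : Fin n) (f : Vec n → ℝ) (x : Vec n) : ℝ :=
  fderiv ℝ f x (Pi.single i 1)

/-- Partial derivative in the `i`-th `y`-coordinate of a function of `(x, y)`. -/
noncomputable def dy {n : ℕ} (i : Fin n) (f : Vec n → Vec n → ℝ) (x y : Vec n) : ℝ :=
  pd i (f x) y

/-- Partial derivative in the `i`-th `x`-coordinate of a function of `(x, y)`. -/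
noncomputable def dx {n : ℕ} (i : Fin n) (f : Vec n → Vec n → ℝ) (x y : Vec n) : ℝ :=
  pd i (fun x' => f x' y) x

/-- The square `F²` of a metric function. -/
noncomputable def F2 {n : ℕ} (F : Vec n → Vec n → ℝ) : Vec n → Vec n → ℝ :=
  fun x y => (F x y) ^ 2

/-- The fundamental tensor `g_{ij}(x,y) = ½ ∂²(F²)/∂yⁱ∂yʲ`. -/
noncomputable def gmat {n : ℕ} (F : Vec n → Vec n → ℝ) (x y : Vec n) :
    Matrix (Fin n) (Fin n) ℝ :=
  Matrix.of fun i j => (1 / 2) * dy i (fun x' y' => dy j (F2 F) x' y') x y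

/-- The inverse fundamental tensor `(g^{ij})`. -/
noncomputable def ginv {n : ℕ} (F : Vec n → Vec n → ℝ) (x y : Vec n) :
    Matrix (Fin n) (Fin n) ℝ :=
  (gmat F x y)⁻¹

/-- The geodesic coefficients
`Gⁱ = ¼ g^{il} (∂²(F²)/∂x^m∂y^l · y^m − ∂(F²)/∂x^l)`. -/
noncomputable def Geo {n : ℕ} (F : Vec n → Vec n → ℝ) (i : Fin n) (x y : Vec n) : ℝ :=
  (1 / 4) * ∑ l, ginv F x y i l *
    ((∑ m, dx m (fun x' y' => dy l (F2 F) x' y') x y * y m) - dx l (F2 F) x y)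

/-- The Riemann curvature
`Rⁱ_k = 2 ∂Gⁱ/∂x^k − ∂²Gⁱ/∂x^j∂y^k y^j + 2 G^j ∂²Gⁱ/∂y^j∂y^k − ∂Gⁱ/∂y^j ∂G^j/∂y^k`. -/
noncomputable def Riem {n : ℕ} (F : Vec n → Vec n → ℝ) (i k : Fin n) (x y : Vec n) : ℝ :=
  2 * dx k (Geo F i) x y
    - (∑ j, dy k (fun x' y' => dx j (Geo F i) x' y') x y * y j)
    + 2 * ∑ j, Geo F j x y * dy j (fun x' y' => dy k (Geo F i) x' y') x y
    - ∑ j, dy j (Geo F i) x y * dy k (Geo F j) x y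

/-- The Ricci curvature `Ric = R^m_m`. -/
noncomputable def RicciC {n : ℕ} (F : Vec n → Vec n → ℝ) (x y : Vec n) : ℝ :=
  ∑ m, Riem F m m x y

/-- The Ricci curvature tensor `Ric_{ij} = ½ ∂²Ric/∂yⁱ∂yʲ`. -/
noncomputable def RicciTensor {n : ℕ} (F : Vec n → Vec n → ℝ) (i j : Fin n)
    (x y : Vec n) : ℝ :=
  (1 / 2) * dy i (fun x' y' => dy j (RicciC F) x' y') x y

/-- The Akbar-Zadeh scalar curvature `r = g^{ij} Ric_{ij}`. -/
noncomputable def scalarCurv {n : ℕ} (F : Vec n → Vec n → ℝ) (x y : Vec n) : ℝ :=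
  ∑ i, ∑ j, ginv F x y i j * RicciTensor F i j x y

/-- The Busemann-Hausdorff volume coefficient
`σ_BH(x) = Vol(𝔹ⁿ) / Vol {y | F(x,y) < 1}`. -/
noncomputable def sigmaBH {n : ℕ} (F : Vec n → Vec n → ℝ) (x : Vec n) : ℝ :=
  (volume {y : Vec n | ∑ i, (y i) ^ 2 < 1}).toReal /
    (volume {y : Vec n | F x y < 1}).toReal

/-- The S-curvature `S(x,y) = ∂G^m/∂y^m − y^m ∂/∂x^m (ln σ_BH)`. -/
noncomputable def SCurv {n : ℕ} (F : Vec n → Vec n → ℝ) (x y : Vec n) : ℝ :=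
  (∑ m, dy m (Geo F m) x y) - ∑ m, y m * pd m (fun x' => Real.log (sigmaBH F x')) x

/-- `F` is a Finsler metric on the open set `U ⊆ ℝⁿ`: it is smooth and positive on
`U × (ℝⁿ \ {0})`, positively 1-homogeneous in `y`, and its fundamental tensor is
positive definite. -/
def IsFinslerOn {n : ℕ} (F : Vec n → Vec n → ℝ) (U : Set (Vec n)) : Prop :=
  ContDiffOn ℝ (⊤ : ℕ∞) (fun p : Vec n × Vec n => F p.1 p.2)
    (U ×ˢ {y : Vec n | y ≠ 0}) ∧
  ∀ x ∈ U, ∀ y : Vec n, y ≠ 0 →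
    0 < F x y ∧ (∀ t : ℝ, 0 < t → F x (t • y) = t * F x y) ∧ (gmat F x y).PosDef

/-- The Riemannian part `α(x,y) = √(a_{ij}(x) yⁱ yʲ)` of a Randers metric. -/
noncomputable def ralpha {n : ℕ} (a : Vec n → Matrix (Fin n) (Fin n) ℝ)
    (x y : Vec n) : ℝ :=
  Real.sqrt (∑ i, ∑ j, a x i j * y i * y j)

/-- The 1-form part `β(x,y) = b_i(x) yⁱ` of a Randers metric. -/
noncomputable def rbeta {n : ℕ} (b : Vec n → Vec n) (x y : Vec n) : ℝ :=
  ∑ i, b x i * y i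

/-- `b(x)² = a^{ij}(x) b_i(x) b_j(x)`, the square of the α-norm of β. -/
noncomputable def bnormsq {n : ℕ} (a : Vec n → Matrix (Fin n) (Fin n) ℝ)
    (b : Vec n → Vec n) (x : Vec n) : ℝ :=
  ∑ i, ∑ j, (a x)⁻¹ i j * b x i * b x j

/-- The data `(a, b)` defines a Randers metric `F = α + β` on `U`:
`a` is a smooth field of symmetric positive definite matrices, `b` is a smooth
field of covectors with `‖β‖_α < 1`, and `F = α + β` is a Finsler metric on `U`. -/
def IsRandersOn {n : ℕ} (a : Vec n → Matrix (Fin n) (Fin n) ℝ) (b : Vec n → Vec n)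
    (U : Set (Vec n)) : Prop :=
  (∀ i j, ContDiffOn ℝ (⊤ : ℕ∞) (fun x => a x i j) U) ∧
  ContDiffOn ℝ (⊤ : ℕ∞) b U ∧
  (∀ x ∈ U, (a x).IsSymm ∧ (a x).PosDef ∧ bnormsq a b x < 1) ∧
  IsFinslerOn (fun x y => ralpha a x y + rbeta b x y) U

/-- `Fb` is a Minkowski norm on ℝⁿ: smooth, positive and positively 1-homogeneous
away from the origin, with positive definite Hessian `½ ∂²(Fb²)/∂yⁱ∂yʲ`. -/
def IsMinkowskiNorm {n : ℕ} (Fb : Vec n → ℝ) : Prop :=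
  ContDiffOn ℝ (⊤ : ℕ∞) Fb {y : Vec n | y ≠ 0} ∧
  ∀ y : Vec n, y ≠ 0 →
    0 < Fb y ∧ (∀ t : ℝ, 0 < t → Fb (t • y) = t * Fb y) ∧
    (Matrix.of fun i j =>
      (1 / 2) * pd i (fun y' => pd j (fun z => (Fb z) ^ 2) y') y).PosDef



/-- Algebraic model of the Randers data on the slit tangent space. -/
structure RD (n : ℕ) (A : Type) [CommRing A] [Algebra ℝ A] where
  D : Fin n → Derivation ℝ A A
  R : Subalgebra ℝ A
  hD : ∀ i f, f ∈ R → D i f ∈ R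
  y : Fin n → A
  hy : ∀ i, y i ∈ R
  Dy : ∀ i j, D i (y j) = if i = j then 1 else 0
  al : A
  ali : A
  hal : al ∈ R
  hali : ali ∈ R
  al_ali : al * ali = 1
  a : Fin n → Fin n → ℝ
  ai : Fin n → Fin n → ℝ
  b : Fin n → ℝ
  asymm : ∀ i j, a i j = a j i
  aisymm : ∀ i j, ai i j = ai j i
  ainv : ∀ i k, ∑ j, a i j * ai j k = if i = k then 1 else 0
  alsq : al * al = ∑ i, ∑ j, algebraMap ℝ A (a i j) * y i * y j
  z : A
  hz : z * (al + ∑ i, algebraMap ℝ A (b i) * y i) = 1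

namespace RD
variable {n : ℕ} {A : Type} [CommRing A] [Algebra ℝ A] (s : RD n A)

noncomputable def be : A := ∑ i, algebraMap ℝ A (s.b i) * s.y i
noncomputable def F : A := s.al + s.be
noncomputable def yl (i : Fin n) : A := ∑ j, algebraMap ℝ A (s.a i j) * s.y j
noncomputable def bu (i : Fin n) : ℝ := ∑ j, s.ai i j * s.b j
noncomputable def bb : ℝ := ∑ i, s.bu i * s.b i
noncomputable def Ap : A := algebraMap ℝ A s.bb * s.al + s.be
noncomputable def lin (c : Fin n → ℝ) : A := ∑ i, algebraMap ℝ A (c i) * s.y i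
/-- Euler derivation. -/
noncomputable def Eu : Derivation ℝ A A := ∑ k, s.y k • s.D k

theorem Eu_apply (f : A) : s.Eu f = ∑ k, s.y k * s.D k f := by
  change Derivation.coeFnAddMonoidHom s.Eu f = _
  rw [Eu, map_sum, Finset.sum_apply]
  rfl

theorem zF : s.z * s.F = 1 := s.hz

theorem two_cancel {u v : A} (h : 2 * u = 2 * v) : u = v := by
  have h2 : algebraMap ℝ A (1/2) * 2 = 1 := by
    rw [show (2 : A) = algebraMap ℝ A 2 from (map_ofNat (algebraMap ℝ A) 2).symm, ← map_mul]; norm_num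
  calc u = algebraMap ℝ A (1/2) * (2 * u) := by rw [← mul_assoc, h2, one_mul]
    _ = v := by rw [h, ← mul_assoc, h2, one_mul]

theorem D_lin (c : Fin n → ℝ) (i : Fin n) : s.D i (s.lin c) = algebraMap ℝ A (c i) := by
  simp [lin, Derivation.leibniz, s.Dy]

theorem D_be (i : Fin n) : s.D i s.be = algebraMap ℝ A (s.b i) := s.D_lin s.b i

theorem D_yl (i j : Fin n) : s.D i (s.yl j) = algebraMap ℝ A (s.a j i) := by
  simp [yl, Derivation.leibniz, s.Dy]

theorem alsq' : s.al * s.al = ∑ i, s.y i * s.yl i := by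
  rw [s.alsq]
  refine Finset.sum_congr rfl fun i _ => ?_
  rw [yl, Finset.mul_sum]
  exact Finset.sum_congr rfl fun j _ => by ring

theorem D_al (i : Fin n) : s.D i s.al = s.ali * s.yl i := by
  have h : s.D i (s.al * s.al) = 2 * s.yl i := by
    rw [s.alsq', map_sum]
    simp only [Derivation.leibniz, D_yl, s.Dy, smul_eq_mul, Finset.sum_add_distrib]
    rw [two_mul]
    congr 1
    · rw [yl]; exact Finset.sum_congr rfl fun j _ => by rw [s.asymm j i]; ring
    · simp
  have h2 : 2 * (s.al * s.D i s.al) = 2 * s.yl i := by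
    rw [← h, Derivation.leibniz, smul_eq_mul]; ring
  have h3 := two_cancel h2
  rw [← h3, ← mul_assoc, mul_comm s.ali, s.al_ali, one_mul]

theorem D_F (i : Fin n) : s.D i s.F = s.ali * s.yl i + algebraMap ℝ A (s.b i) := by
  rw [F, map_add, D_al, D_be]

theorem D_z (i : Fin n) : s.D i s.z = - (s.z * s.z * s.D i s.F) := by
  have h : s.D i (s.z * s.F) = 0 := by rw [s.zF]; simp
  rw [Derivation.leibniz, smul_eq_mul, smul_eq_mul] at h
  linear_combination s.z * h - s.D i s.z * s.zF

theorem D_ali (i : Fin n) : s.D i s.ali = - (s.ali * s.ali * s.ali * s.yl i) := by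
  have h : s.D i (s.al * s.ali) = 0 := by rw [s.al_ali]; simp
  rw [Derivation.leibniz, smul_eq_mul, smul_eq_mul, D_al] at h
  linear_combination s.ali * h - s.D i s.ali * s.al_ali

theorem Eu_y (i : Fin n) : s.Eu (s.y i) = s.y i := by
  simp [Eu_apply, s.Dy]

theorem Eu_C (r : ℝ) : s.Eu (algebraMap ℝ A r) = 0 := by simp

theorem Eu_lin (c : Fin n → ℝ) : s.Eu (s.lin c) = s.lin c := by
  rw [Eu_apply, lin]
  exact Finset.sum_congr rfl fun i _ => by rw [← lin, D_lin]; ring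

theorem Eu_be : s.Eu s.be = s.be := s.Eu_lin s.b

theorem Eu_al : s.Eu s.al = s.al := by
  rw [Eu_apply]
  simp only [D_al]
  rw [show ∑ k, s.y k * (s.ali * s.yl k) = s.ali * ∑ k, s.y k * s.yl k by
    rw [Finset.mul_sum]; exact Finset.sum_congr rfl fun j _ => by ring, ← s.alsq']
  linear_combination s.al * s.al_ali

theorem Eu_F : s.Eu s.F = s.F := by rw [F, map_add, Eu_al, Eu_be]

theorem Eu_Ap : s.Eu s.Ap = s.Ap := by
  rw [Ap, map_add, Derivation.leibniz, Eu_al, Eu_be, Eu_C]; simp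

theorem Eu_z : s.Eu s.z = - s.z := by
  have h : s.Eu (s.z * s.F) = 0 := by rw [s.zF]; simp
  rw [Derivation.leibniz, smul_eq_mul, smul_eq_mul, Eu_F] at h
  linear_combination s.z * h - (s.Eu s.z + s.z) * s.zF

/-! memberships -/
theorem hC (r : ℝ) : algebraMap ℝ A r ∈ s.R := s.R.algebraMap_mem r
theorem hlin (c : Fin n → ℝ) : s.lin c ∈ s.R :=
  sum_mem fun i _ => mul_mem (s.hC _) (s.hy i)
theorem hbe : s.be ∈ s.R := s.hlin s.b
theorem hyl (i : Fin n) : s.yl i ∈ s.R := s.hlin _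
theorem hF : s.F ∈ s.R := add_mem s.hal s.hbe
theorem hAp : s.Ap ∈ s.R := add_mem (mul_mem (s.hC _) s.hal) s.hbe
theorem hEu {f : A} (h : f ∈ s.R) : s.Eu f ∈ s.R := by
  rw [Eu_apply]; exact sum_mem fun i _ => mul_mem (s.hy i) (s.hD i f h)

/-- `z ^ k R` -/
def I (k : ℕ) : Submodule s.R A where
  carrier := {f | ∃ q ∈ s.R, f = s.z ^ k * q}
  add_mem' := by
    rintro _ _ ⟨p, hp, rfl⟩ ⟨q, hq, rfl⟩
    exact ⟨p + q, add_mem hp hq, by ring⟩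
  zero_mem' := ⟨0, zero_mem _, by ring⟩
  smul_mem' := by
    rintro ⟨c, hc⟩ _ ⟨q, hq, rfl⟩
    exact ⟨c * q, mul_mem hc hq, by
      change c * _ = _
      ring⟩

theorem mem_I {k : ℕ} {f : A} : f ∈ s.I k ↔ ∃ q ∈ s.R, f = s.z ^ k * q := Iff.rfl

theorem I_mk (k : ℕ) {q : A} (h : q ∈ s.R) : s.z ^ k * q ∈ s.I k := ⟨q, h, rfl⟩

theorem I_succ {k : ℕ} {f : A} (h : f ∈ s.I k) : s.F * f ∈ s.I k := by
  obtain ⟨q, hq, rfl⟩ := h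
  exact ⟨s.F * q, mul_mem s.hF hq, by ring⟩

theorem I_up {k : ℕ} {f : A} (h : f ∈ s.I k) : f ∈ s.I (k+1) := by
  obtain ⟨q, hq, rfl⟩ := h
  exact ⟨s.F * q, mul_mem s.hF hq, by
    linear_combination (- s.z ^ k * q) * s.zF⟩

theorem I_le {k l : ℕ} (hkl : k ≤ l) {f : A} (h : f ∈ s.I k) : f ∈ s.I l := by
  induction l, hkl using Nat.le_induction with
  | base => exact h
  | succ m _ ih => exact s.I_up ih

theorem I_mul {k l : ℕ} {f g : A} (hf : f ∈ s.I k) (hg : g ∈ s.I l) : f * g ∈ s.I (k + l) := by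
  obtain ⟨p, hp, rfl⟩ := hf
  obtain ⟨q, hq, rfl⟩ := hg
  exact ⟨p * q, mul_mem hp hq, by ring⟩

theorem I_zero {f : A} (h : f ∈ s.R) : f ∈ s.I 0 := ⟨f, h, by ring⟩

theorem I_Rmul {k : ℕ} {f g : A} (hf : f ∈ s.R) (hg : g ∈ s.I k) : f * g ∈ s.I k := by
  simpa using s.I_mul (s.I_zero hf) hg

/-! Sums with `F_j`. -/
theorem sum_ai_yl (c : Fin n → ℝ) :
    ∑ j, algebraMap ℝ A (∑ k, s.ai j k * c k) * s.yl j = s.lin c := by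
  simp only [yl, lin, Finset.mul_sum]
  rw [Finset.sum_comm]
  refine Finset.sum_congr rfl fun m _ => ?_
  simp only [← mul_assoc, ← map_mul, ← Finset.sum_mul, ← map_sum]
  congr 2
  simp only [Finset.sum_mul]
  rw [Finset.sum_comm]
  have : ∀ k, ∑ j, s.ai j k * c k * s.a j m = (if m = k then 1 else 0) * c k := by
    intro k
    rw [← s.ainv m k, Finset.sum_mul]
    exact Finset.sum_congr rfl fun j _ => by rw [s.asymm j m]; ring
  simp [this]



theorem Div_eq (p : A) (S : Fin n → A) (hp : s.Eu p = p) :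
    ∑ k, s.D k (p * s.y k + S k) = ((n : A) + 1) * p + ∑ k, s.D k (S k) := by
  simp only [map_add, Derivation.leibniz, s.Dy, smul_eq_mul, Finset.sum_add_distrib, if_true,
    ← s.Eu_apply, hp]
  simp
  ring

theorem trace_eq (p : A) (S : Fin n → A) (hp : s.Eu p = p) (hS : ∀ i, s.Eu (S i) = 2 * S i) :
    ∑ m, ∑ j, s.D j (p * s.y m + S m) * s.D m (p * s.y j + S j) =
      ((n : A) + 3) * p * p + 4 * ∑ j, s.D j p * S j + 2 * p * ∑ k, s.D k (S k)
        + ∑ m, ∑ j, s.D j (S m) * s.D m (S j) := by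
  have e : ∀ m j, s.D j (p * s.y m + S m) * s.D m (p * s.y j + S j) =
      (s.y j * s.D j p) * (s.y m * s.D m p) + (if j = m then 2 * p * (s.y j * s.D j p) else 0)
      + (if j = m then p * p else 0) + s.D j p * (s.y m * s.D m (S j))
      + s.D m p * (s.y j * s.D j (S m)) + (if j = m then 2 * p * s.D j (S j) else 0)
      + s.D j (S m) * s.D m (S j) := by
    intro m j
    simp only [map_add, Derivation.leibniz, s.Dy, smul_eq_mul]
    by_cases h : j = m
    · subst h; simp; ring
    · simp [h, Ne.symm h]; ring
  simp only [e, Finset.sum_add_distrib, Finset.sum_ite_eq', Finset.mem_univ, if_true,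
    ← Finset.mul_sum, ← Finset.sum_mul, ← s.Eu_apply, hp, hS]
  rw [Finset.sum_comm (f := fun m j => s.D j p * (s.y m * s.D m (S j)))]
  simp only [← Finset.mul_sum, ← s.Eu_apply, hS]
  simp only [Finset.sum_const, Finset.card_univ, Fintype.card_fin, nsmul_eq_mul]
  rw [show ∑ j, s.D j p * (2 * S j) = 2 * ∑ j, s.D j p * S j by
    rw [Finset.mul_sum]; exact Finset.sum_congr rfl fun j _ => by ring]
  ring

theorem I_n {k : ℕ} {f : A} (c : ℕ) (h : f ∈ s.I k) : (c : A) * f ∈ s.I k :=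
  s.I_Rmul (natCast_mem s.R c) h

theorem ricq (V u : A) (S : Fin n → A) (hV : V ∈ s.R) (hu : u ∈ s.R) (hS : ∀ i, S i ∈ s.R)
    (EV : s.Eu V = 2 * V) (ES : ∀ i, s.Eu (S i) = 2 * S i)
    (hFS : ∑ j, s.D j s.F * S j = - V + s.F * u) :
    2 * (∑ m, ∑ j, (s.z * V * s.y j + S j) * s.D j (s.D m (s.z * V * s.y m + S m)))
     - (∑ m, ∑ j, s.D j (s.z * V * s.y m + S m) * s.D m (s.z * V * s.y j + S j))
     - 3 * ((n : A) - 1) * (s.z ^ 2 * V ^ 2) ∈ s.I 1 := by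
  have hp : s.Eu (s.z * V) = s.z * V := by
    rw [Derivation.leibniz, EV, s.Eu_z, smul_eq_mul, smul_eq_mul]; ring
  rw [s.trace_eq _ _ hp ES, Finset.sum_comm]
  have hDiv := s.Div_eq _ S hp
  set σ := ∑ k, s.D k (S k) with hσ
  have hσR : σ ∈ s.R := sum_mem fun k _ => s.hD k _ (hS k)
  have e1 : ∑ j, ∑ m, (s.z * V * s.y j + S j) * s.D j (s.D m (s.z * V * s.y m + S m)) =
      s.z * V * (((n : A) + 1) * (s.z * V) + s.Eu σ)
      + (((n : A) + 1) * ∑ j, s.D j (s.z * V) * S j + ∑ j, S j * s.D j σ) := by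
    have : ∀ j, ∑ m, (s.z * V * s.y j + S j) * s.D j (s.D m (s.z * V * s.y m + S m)) =
        s.z * V * (s.y j * s.D j (((n : A) + 1) * (s.z * V) + σ))
          + (((n : A) + 1) * (s.D j (s.z * V) * S j) + S j * s.D j σ) := by
      intro j
      rw [← Finset.mul_sum, ← map_sum, hDiv, map_add, Derivation.leibniz (s.D j) ((n : A) + 1)]
      simp
      ring
    simp only [this, Finset.sum_add_distrib, ← Finset.mul_sum, ← s.Eu_apply]
    rw [map_add, Derivation.leibniz s.Eu ((n : A) + 1), hp]
    simp
  have e2 : ∑ j, s.D j (s.z * V) * S j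
      = s.z ^ 2 * V ^ 2 + s.z * ((∑ j, s.D j V * S j) - V * u) := by
    have : ∀ j, s.D j (s.z * V) * S j =
        s.z * (s.D j V * S j) - s.z * s.z * V * (s.D j s.F * S j) := by
      intro j
      rw [Derivation.leibniz, s.D_z, smul_eq_mul, smul_eq_mul]; ring
    simp only [this, Finset.sum_sub_distrib, ← Finset.mul_sum]
    rw [hFS]
    linear_combination (-s.z * V * u) * s.zF
  rw [e1, e2]
  have hw : (∑ j, s.D j V * S j) - V * u ∈ s.R :=
    sub_mem (sum_mem fun j _ => mul_mem (s.hD j _ hV) (hS j)) (mul_mem hV hu)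
  set w := (∑ j, s.D j V * S j) - V * u
  have h1 : ∑ j, S j * s.D j σ ∈ s.R := sum_mem fun j _ => mul_mem (hS j) (s.hD j _ hσR)
  have h2 : ∑ m, ∑ j, s.D j (S m) * s.D m (S j) ∈ s.R :=
    sum_mem fun j _ => sum_mem fun m _ => mul_mem (s.hD _ _ (hS _)) (s.hD _ _ (hS _))
  set t1 := ∑ j, S j * s.D j σ
  set t2 := ∑ m, ∑ j, s.D j (S m) * s.D m (S j)
  have h3 := s.hEu hσR
  have hn : (n : A) ∈ s.R := natCast_mem _ n
  have h2R : (2 : A) ∈ s.R := ofNat_mem _ 2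
  refine ⟨2 * (V * s.Eu σ) + 2 * ((n + 1) * w) - 2 * (2 * w) - 2 * (V * σ) + s.F * (2 * t1 - t2),
    ?_, ?_⟩
  · have := s.hF
    have h1R : (1 : A) ∈ s.R := one_mem _
    repeat' first | assumption | apply add_mem | apply sub_mem | apply mul_mem
  · linear_combination (- (2 * t1 - t2)) * s.zF

theorem sum_bu_DF : s.al * ∑ j, algebraMap ℝ A (s.bu j) * s.D j s.F = s.Ap := by
  simp only [D_F, mul_add, Finset.sum_add_distrib]
  have h1 := s.sum_ai_yl s.b
  have h2 : ∑ j, algebraMap ℝ A (s.bu j) * (s.ali * s.yl j) = s.ali * s.be := by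
    rw [be, ← lin, ← h1, Finset.mul_sum]
    exact Finset.sum_congr rfl fun j _ => by rw [bu]; ring
  rw [h2, Ap, bb]
  simp only [map_sum, map_mul]
  linear_combination s.be * s.al_ali

theorem sum_ai_DF (i : Fin n) : ∑ j, algebraMap ℝ A (s.ai i j) * s.D j s.F =
    s.ali * s.y i + algebraMap ℝ A (s.bu i) := by
  have := s.sum_ai_yl (fun j => if j = i then 1 else 0)
  simp [lin] at this
  simp only [D_F, mul_add, Finset.sum_add_distrib, bu, map_sum, map_mul]
  congr 1
  rw [← this, Finset.mul_sum]
  exact Finset.sum_congr rfl fun j _ => by rw [s.aisymm]; ring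

/-- `F³ g^{ij}`. -/
noncomputable def M (i j : Fin n) : A :=
  s.z ^ 3 * (s.al * s.F * s.F * algebraMap ℝ A (s.ai i j)
    - s.al * s.F * (algebraMap ℝ A (s.bu i) * s.y j + algebraMap ℝ A (s.bu j) * s.y i)
    + s.Ap * s.y i * s.y j)

theorem DD_F (i j : Fin n) : s.D i (s.D j s.F) =
    s.ali * algebraMap ℝ A (s.a j i) - s.ali * s.ali * s.ali * s.yl i * s.yl j := by
  rw [D_F, map_add, Derivation.leibniz, D_yl, D_ali]
  simp
  ring

theorem hDF (i : Fin n) : s.D i s.F ∈ s.R := s.hD _ _ s.hF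

theorem y_DDF (i : Fin n) : ∑ j, s.y j * s.D i (s.D j s.F) = 0 := by
  have : s.D i (∑ j, s.y j * s.D j s.F) = s.D i s.F := by rw [← s.Eu_apply, s.Eu_F]
  rw [map_sum] at this
  simp only [Derivation.leibniz, Finset.sum_add_distrib, smul_eq_mul, s.Dy] at this
  simpa using this

theorem y_DDF' (j : Fin n) : ∑ i, s.y i * s.D i (s.D j s.F) = 0 := by
  rw [← s.y_DDF j]
  refine Finset.sum_congr rfl fun i _ => ?_
  rw [DD_F, DD_F, s.asymm i j]; ring

/-- `g_{ij}`. -/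
theorem half_DD (i j : Fin n) : s.D i (s.D j (s.F ^ 2)) =
    2 * (s.D i s.F * s.D j s.F + s.F * s.D i (s.D j s.F)) := by
  rw [pow_two, Derivation.leibniz, map_add, smul_eq_mul, Derivation.leibniz]
  simp
  ring


theorem sum_DF_y : ∑ j, s.D j s.F * s.y j = s.F := by
  have h := s.Eu_F
  rw [s.Eu_apply] at h
  rw [← Finset.sum_congr rfl fun j _ => mul_comm (s.y j) (s.D j s.F)]
  exact h

theorem sum_DF_M (k : Fin n) : ∑ j, s.D j s.F * s.M j k = s.z * s.y k := by
  have e : ∀ j, s.D j s.F * s.M j k =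
      s.z ^ 3 * s.al * s.F * s.F * (algebraMap ℝ A (s.ai k j) * s.D j s.F)
      - s.z ^ 3 * s.F * s.y k * (s.al * (algebraMap ℝ A (s.bu j) * s.D j s.F))
      - s.z ^ 3 * s.al * s.F * algebraMap ℝ A (s.bu k) * (s.D j s.F * s.y j)
      + s.z ^ 3 * s.Ap * s.y k * (s.D j s.F * s.y j) := by
    intro j; rw [M, s.aisymm k j]; ring
  simp only [e, Finset.sum_add_distrib, Finset.sum_sub_distrib, ← Finset.mul_sum, sum_ai_DF,
    sum_DF_y, sum_bu_DF]
  linear_combination s.z ^ 3 * s.F * s.F * s.y k * s.al_ali +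
    s.z * s.y k * (s.z * s.F + 1) * s.zF

theorem sum_DDF_bu (i : Fin n) : ∑ j, s.D i (s.D j s.F) * algebraMap ℝ A (s.bu j) =
    s.ali * algebraMap ℝ A (s.b i) - s.ali * s.ali * s.ali * s.yl i * s.be := by
  have h1 := s.sum_ai_yl s.b
  have h2 : ∑ j, algebraMap ℝ A (s.a j i) * algebraMap ℝ A (s.bu j) = algebraMap ℝ A (s.b i) := by
    simp only [← map_mul, ← map_sum]
    congr 1
    simp only [bu, Finset.mul_sum]
    rw [Finset.sum_comm]
    have : ∀ k, ∑ j, s.a j i * (s.ai j k * s.b k) = (if i = k then 1 else 0) * s.b k := by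
      intro k
      rw [← s.ainv i k, Finset.sum_mul]
      exact Finset.sum_congr rfl fun j _ => by rw [s.asymm j i]; ring
    simp [this]
  rw [be, ← lin, ← h1, ← h2]
  simp only [Finset.mul_sum, ← Finset.sum_sub_distrib]
  exact Finset.sum_congr rfl fun j _ => by rw [DD_F, bu]; ring

theorem sum_DDF_ai (i k : Fin n) : ∑ j, s.D i (s.D j s.F) * algebraMap ℝ A (s.ai j k) =
    s.ali * (if i = k then 1 else 0) - s.ali * s.ali * s.ali * s.yl i * s.y k := by
  have h1 := s.sum_ai_yl (fun j => if j = k then 1 else 0)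
  simp [lin] at h1
  have h2 : ∑ j, algebraMap ℝ A (s.a j i) * algebraMap ℝ A (s.ai j k) = if i = k then 1 else 0 := by
    simp only [← map_mul, ← map_sum, s.asymm _ i]
    rw [s.ainv i k]; split_ifs <;> simp
  rw [← h1, ← h2]
  simp only [Finset.mul_sum, ← Finset.sum_sub_distrib]
  exact Finset.sum_congr rfl fun j _ => by rw [DD_F]; ring

theorem sum_DDF_M (i k : Fin n) : s.F * ∑ j, s.D i (s.D j s.F) * s.M j k =
    (if i = k then 1 else 0) - s.z * s.y k * s.D i s.F := by
  have e : ∀ j, s.D i (s.D j s.F) * s.M j k =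
      s.z ^ 3 * s.al * s.F * s.F * (s.D i (s.D j s.F) * algebraMap ℝ A (s.ai j k))
      - s.z ^ 3 * s.al * s.F * s.y k * (s.D i (s.D j s.F) * algebraMap ℝ A (s.bu j))
      - s.z ^ 3 * s.al * s.F * algebraMap ℝ A (s.bu k) * (s.y j * s.D i (s.D j s.F))
      + s.z ^ 3 * s.Ap * s.y k * (s.y j * s.D i (s.D j s.F)) := by
    intro j; rw [M]; ring
  simp only [e, Finset.sum_add_distrib, Finset.sum_sub_distrib, ← Finset.mul_sum, sum_DDF_ai,
    sum_DDF_bu, y_DDF]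
  rw [D_F]
  generalize (if i = k then (1 : A) else 0) = d
  have h1 : s.F = s.al + s.be := rfl
  have h2 := s.zF
  have h3 := s.al_ali
  have h4 : s.z ^ 3 * s.F ^ 3 = 1 := by rw [← mul_pow, h2, one_pow]
  have h5 : s.z ^ 3 * s.F ^ 2 = s.z := by linear_combination s.z * (s.z * s.F + 1) * h2
  have h6 : s.be = s.F - s.al := by rw [h1]; ring
  rw [h6]
  generalize algebraMap ℝ A (s.b i) = bi
  linear_combination (s.z^3 * s.F^3 * d - s.z ^ 3 * s.F^2 * s.y k * bi
    - s.z^3 * s.F^2 * s.y k * s.yl i * s.ali * (s.al * s.ali + 1)) * h3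
    + d * h4 - s.y k * (bi + s.ali * s.yl i) * h5

theorem g_M (i k : Fin n) :
    ∑ j, (s.D i s.F * s.D j s.F + s.F * s.D i (s.D j s.F)) * s.M j k = if i = k then 1 else 0 := by
  have e : ∀ j, (s.D i s.F * s.D j s.F + s.F * s.D i (s.D j s.F)) * s.M j k =
    s.D i s.F * (s.D j s.F * s.M j k) + s.F * (s.D i (s.D j s.F) * s.M j k) := by intro j; ring
  simp only [e, Finset.sum_add_distrib, ← Finset.mul_sum, sum_DF_M, sum_DDF_M]
  ring

theorem M_symm (i j : Fin n) : s.M i j = s.M j i := by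
  rw [M, M, s.aisymm]; ring

theorem sum_ai_DF_DF : s.al * ∑ i, ∑ j, algebraMap ℝ A (s.ai i j) * (s.D i s.F * s.D j s.F)
    = s.Ap + s.F := by
  have e : ∀ i, ∑ j, algebraMap ℝ A (s.ai i j) * (s.D i s.F * s.D j s.F) =
      s.ali * (s.D i s.F * s.y i) + algebraMap ℝ A (s.bu i) * s.D i s.F := by
    intro i
    rw [show s.ali * (s.D i s.F * s.y i) + algebraMap ℝ A (s.bu i) * s.D i s.F =
      s.D i s.F * (s.ali * s.y i + algebraMap ℝ A (s.bu i)) by ring, ← s.sum_ai_DF,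
      Finset.mul_sum]
    exact Finset.sum_congr rfl fun j _ => by ring
  simp only [e, Finset.sum_add_distrib, ← Finset.mul_sum, sum_DF_y]
  linear_combination s.F * s.al_ali + s.sum_bu_DF

theorem DDP (E : A) (i j : Fin n) : s.D i (s.D j (s.z ^ 2 * E)) =
    s.z ^ 2 * s.D i (s.D j E) - 2 * s.z ^ 3 * (s.D i s.F * s.D j E + s.D j s.F * s.D i E
      + s.D i (s.D j s.F) * E) + 6 * s.z ^ 4 * (s.D i s.F * s.D j s.F * E) := by
  simp only [pow_two, Derivation.leibniz, smul_eq_mul, map_add, D_z, map_neg]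
  ring

theorem contr_y (E q : A) (hE : E ∈ s.R) (hq : q ∈ s.R) (EE : s.Eu E = 4 * E + s.F * q)
    (i : Fin n) : ∃ r ∈ s.R, ∑ j, s.y j * s.D i (s.D j (s.z ^ 2 * E)) =
      - 2 * s.z ^ 3 * (s.D i s.F * E) + s.z ^ 2 * r := by
  refine ⟨∑ j, s.y j * s.D i (s.D j E) - 2 * s.D i E - 2 * s.D i s.F * q, ?_, ?_⟩
  · have h2R : (2 : A) ∈ s.R := ofNat_mem _ 2
    exact sub_mem (sub_mem (sum_mem fun j _ => mul_mem (s.hy j) (s.hD _ _ (s.hD _ _ hE)))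
      (mul_mem h2R (s.hD _ _ hE))) (mul_mem (mul_mem h2R (s.hDF i)) hq)
  · have e : ∀ j, s.y j * s.D i (s.D j (s.z ^ 2 * E)) =
      s.z ^ 2 * (s.y j * s.D i (s.D j E)) - 2 * s.z ^ 3 * s.D i s.F * (s.y j * s.D j E)
      - 2 * s.z ^ 3 * s.D i E * (s.D j s.F * s.y j) - 2 * s.z ^ 3 * E *
        (s.y j * s.D i (s.D j s.F)) + 6 * s.z ^ 4 * E * s.D i s.F * (s.D j s.F * s.y j) := by
      intro j; rw [DDP]; ring
    simp only [e, Finset.sum_add_distrib, Finset.sum_sub_distrib, ← Finset.mul_sum, y_DDF,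
      sum_DF_y, ← s.Eu_apply, EE]
    linear_combination (- 2 * s.z^2 * s.D i E - 2 * s.z ^2 * s.D i s.F * q
      + 6 * s.z ^ 3 * E * s.D i s.F) * s.zF

theorem contr_y' (E q : A) (hE : E ∈ s.R) (hq : q ∈ s.R) (EE : s.Eu E = 4 * E + s.F * q)
    (j : Fin n) : ∃ r ∈ s.R, ∑ i, s.y i * s.D i (s.D j (s.z ^ 2 * E)) =
      - 2 * s.z ^ 3 * (s.D j s.F * E) + s.z ^ 2 * r := by
  refine ⟨∑ i, s.y i * s.D i (s.D j E) - 2 * s.D j E - 2 * s.D j s.F * q, ?_, ?_⟩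
  · have h2R : (2 : A) ∈ s.R := ofNat_mem _ 2
    exact sub_mem (sub_mem (sum_mem fun i _ => mul_mem (s.hy i) (s.hD _ _ (s.hD _ _ hE)))
      (mul_mem h2R (s.hD _ _ hE))) (mul_mem (mul_mem h2R (s.hDF j)) hq)
  · have e : ∀ i, s.y i * s.D i (s.D j (s.z ^ 2 * E)) =
      s.z ^ 2 * (s.y i * s.D i (s.D j E)) - 2 * s.z ^ 3 * s.D j s.F * (s.y i * s.D i E)
      - 2 * s.z ^ 3 * s.D j E * (s.D i s.F * s.y i) - 2 * s.z ^ 3 * E *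
        (s.y i * s.D i (s.D j s.F)) + 6 * s.z ^ 4 * E * s.D j s.F * (s.D i s.F * s.y i) := by
      intro i; rw [DDP]; ring
    simp only [e, Finset.sum_add_distrib, Finset.sum_sub_distrib, ← Finset.mul_sum,
      sum_DF_y, ← s.Eu_apply, EE, (s.Eu_apply _).trans (s.y_DDF' j)]
    linear_combination (- 2 * s.z^2 * s.D j E - 2 * s.z ^2 * s.D j s.F * q
      + 6 * s.z ^ 3 * E * s.D j s.F) * s.zF

theorem contr_yy (E q : A) (hq : q ∈ s.R) (EE : s.Eu E = 4 * E + s.F * q) :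
    ∃ r ∈ s.R, ∑ i, ∑ j, s.y i * s.y j * s.D i (s.D j (s.z ^ 2 * E)) =
      2 * s.z ^ 2 * E + s.z * r := by
  have h1 : s.Eu (s.z ^ 2 * E) = s.z ^ 2 * (2 * E + s.F * q) := by
    simp only [pow_two, Derivation.leibniz, smul_eq_mul, Eu_z, EE]
    ring
  have h2 : ∑ i, ∑ j, s.y i * s.y j * s.D i (s.D j (s.z ^ 2 * E)) =
      s.Eu (s.Eu (s.z ^ 2 * E)) - s.Eu (s.z ^ 2 * E) := by
    rw [s.Eu_apply (s.Eu _), s.Eu_apply (s.z ^ 2 * E), ← Finset.sum_sub_distrib]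
    refine Finset.sum_congr rfl fun i _ => ?_
    rw [map_sum]
    simp only [Derivation.leibniz, smul_eq_mul, s.Dy, Finset.sum_add_distrib]
    simp [mul_add, Finset.mul_sum, mul_assoc]
  refine ⟨s.Eu q, s.hEu hq, ?_⟩
  · rw [h2, h1]
    simp only [pow_two, Derivation.leibniz, smul_eq_mul, map_add, Eu_z, EE, Eu_F,
      show s.Eu (2 : A) = 0 from s.Eu.map_natCast 2]
    linear_combination (s.z * s.Eu q) * s.zF


theorem final_contr (L q : A) (hL : L ∈ s.R) (hq : q ∈ s.R) (EL : s.Eu L = 4 * L) :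
    ∃ r ∈ s.R, ∑ i, ∑ j, s.M i j * s.D i (s.D j (s.z ^ 2 * L + s.z * q)) =
      12 * s.z ^ 5 * s.Ap * L + s.z ^ 4 * r := by
  have hP : s.z ^ 2 * L + s.z * q = s.z ^ 2 * (L + s.F * q) := by
    linear_combination (- s.z * q) * s.zF
  rw [hP]
  have hE : L + s.F * q ∈ s.R := add_mem hL (mul_mem s.hF hq)
  have EE : s.Eu (L + s.F * q) = 4 * (L + s.F * q) + s.F * (s.Eu q - 3 * q) := by
    rw [map_add, Derivation.leibniz, Eu_F, EL, smul_eq_mul, smul_eq_mul]; ring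
  have hE' : L + s.F * q = L + s.F * q := rfl
  set E := L + s.F * q with hEdef
  have hq2 : s.Eu q - 3 * q ∈ s.R := sub_mem (s.hEu hq) (mul_mem (ofNat_mem _ 3) hq)
  choose r1 hr1 e1 using s.contr_y E _ hE hq2 EE
  choose r2 hr2 e2 using s.contr_y' E _ hE hq2 EE
  obtain ⟨r3, hr3, e3⟩ := s.contr_yy E _ hq2 EE
  -- the `a^{ij}` part
  set t := ∑ i, ∑ j, algebraMap ℝ A (s.ai i j) * (s.F * s.D i (s.D j E)
    - 2 * (s.D i s.F * s.D j E + s.D j s.F * s.D i E + s.D i (s.D j s.F) * E)) with ht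
  have h2R : (2 : A) ∈ s.R := ofNat_mem _ 2
  have h4R : (4 : A) ∈ s.R := ofNat_mem _ 4
  have h6R : (6 : A) ∈ s.R := ofNat_mem _ 6
  have h12R : (12 : A) ∈ s.R := ofNat_mem _ 12
  have hF := s.hF
  have hal := s.hal
  have hAp := s.hAp
  have htR : t ∈ s.R := by
    refine sum_mem fun i _ => sum_mem fun j _ => ?_
    have := s.hC (s.ai i j)
    have := s.hDF i
    have := s.hDF j
    have := s.hD i _ hE
    have := s.hD j _ hE
    have := s.hD i _ (s.hD j _ hE)
    have := s.hD i _ (s.hDF j)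
    repeat' first | assumption | apply add_mem | apply sub_mem | apply mul_mem
  have e0 : ∑ i, ∑ j, algebraMap ℝ A (s.ai i j) * s.D i (s.D j (s.z ^ 2 * E)) =
      s.z ^ 3 * t + 6 * s.z ^ 4 * E *
        ∑ i, ∑ j, algebraMap ℝ A (s.ai i j) * (s.D i s.F * s.D j s.F) := by
    rw [ht]
    simp only [Finset.mul_sum, ← Finset.sum_add_distrib]
    refine Finset.sum_congr rfl fun i _ => Finset.sum_congr rfl fun j _ => ?_
    rw [DDP]
    linear_combination (-s.z ^2 * algebraMap ℝ A (s.ai i j) * s.D i (s.D j E)) * s.zF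
  have f1 : ∑ i, algebraMap ℝ A (s.bu i) * ∑ j, s.y j * s.D i (s.D j (s.z ^ 2 * E)) =
      - 2 * s.z ^ 3 * E * (∑ i, algebraMap ℝ A (s.bu i) * s.D i s.F) +
      s.z ^ 2 * ∑ i, algebraMap ℝ A (s.bu i) * r1 i := by
    simp only [e1, Finset.mul_sum, ← Finset.sum_add_distrib]
    exact Finset.sum_congr rfl fun i _ => by ring
  have f2 : ∑ i, algebraMap ℝ A (s.bu i) * ∑ j, s.y j * s.D j (s.D i (s.z ^ 2 * E)) =
      - 2 * s.z ^ 3 * E * (∑ i, algebraMap ℝ A (s.bu i) * s.D i s.F) +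
      s.z ^ 2 * ∑ i, algebraMap ℝ A (s.bu i) * r2 i := by
    simp only [e2, Finset.mul_sum, ← Finset.sum_add_distrib]
    exact Finset.sum_congr rfl fun i _ => by ring
  have hw1 : ∑ i, algebraMap ℝ A (s.bu i) * r1 i ∈ s.R :=
    sum_mem fun i _ => mul_mem (s.hC _) (hr1 i)
  have hw2 : ∑ i, algebraMap ℝ A (s.bu i) * r2 i ∈ s.R :=
    sum_mem fun i _ => mul_mem (s.hC _) (hr2 i)
  set w1 := ∑ i, algebraMap ℝ A (s.bu i) * r1 i
  set w2 := ∑ i, algebraMap ℝ A (s.bu i) * r2 i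
  have hM : ∑ i, ∑ j, s.M i j * s.D i (s.D j (s.z ^ 2 * E)) =
      s.z ^ 3 * s.al * s.F * s.F * (∑ i, ∑ j, algebraMap ℝ A (s.ai i j) *
        s.D i (s.D j (s.z ^ 2 * E)))
      - s.z ^ 3 * s.al * s.F * (∑ i, algebraMap ℝ A (s.bu i) *
        ∑ j, s.y j * s.D i (s.D j (s.z ^ 2 * E)))
      - s.z ^ 3 * s.al * s.F * (∑ i, algebraMap ℝ A (s.bu i) *
        ∑ j, s.y j * s.D j (s.D i (s.z ^ 2 * E)))
      + s.z ^ 3 * s.Ap * (∑ i, ∑ j, s.y i * s.y j * s.D i (s.D j (s.z ^ 2 * E))) := by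
    have : ∑ i, algebraMap ℝ A (s.bu i) * ∑ j, s.y j * s.D j (s.D i (s.z ^ 2 * E)) =
       ∑ i, ∑ j, algebraMap ℝ A (s.bu j) * (s.y i * s.D i (s.D j (s.z ^ 2 * E))) := by
      rw [Finset.sum_comm]
      simp only [Finset.mul_sum]
    rw [this]
    simp only [Finset.mul_sum, ← Finset.sum_add_distrib, ← Finset.sum_sub_distrib]
    refine Finset.sum_congr rfl fun i _ => Finset.sum_congr rfl fun j _ => ?_
    rw [M]; ring
  rw [hM, e0, f1, f2, e3]
  have g1 := s.sum_bu_DF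
  have g2 := s.sum_ai_DF_DF
  have g3 := s.zF
  generalize ∑ i, ∑ j, algebraMap ℝ A (s.ai i j) * (s.D i s.F * s.D j s.F) = X at *
  generalize ∑ i, algebraMap ℝ A (s.bu i) * s.D i s.F = Y at *
  refine ⟨s.al * t + 6 * E - s.al * w1 - s.al * w2 + s.Ap * r3 + 12 * s.Ap * q, ?_, ?_⟩
  · repeat' first | assumption | apply add_mem | apply sub_mem | apply mul_mem
  · have k1 : s.z ^ 3 * s.F * s.F = s.z := by linear_combination s.z * (s.z * s.F + 1) * g3
    have k2 : s.z ^ 3 * s.F = s.z ^ 2 := by linear_combination s.z ^ 2 * g3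
    have k3 : s.z ^ 5 * s.F = s.z ^ 4 := by linear_combination s.z ^ 4 * g3
    have k4 : E = L + s.F * q := hEdef
    linear_combination (s.al * (s.z ^ 3 * t + 6 * s.z ^ 4 * E * X)) * k1
      - s.al * (-4 * s.z ^ 3 * E * Y + s.z ^ 2 * w1 + s.z ^ 2 * w2) * k2
      + 6 * s.z ^ 5 * E * g2 + 4 * s.z ^ 5 * E * g1 + 6 * E * k3 + 12 * s.z ^ 5 * s.Ap * k4
      + 12 * s.Ap * q * k3

/-! The concrete spray -/
noncomputable def W (i m : Fin n) : A :=
  s.y i * s.y m - algebraMap ℝ A (1/2) * (s.F ^ 2 * s.M i m)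
noncomputable def Vm (m : Fin n) : A := - (algebraMap ℝ A (1/2) * s.Ap * s.y m)
noncomputable def Sm (i m : Fin n) : A :=
  s.y i * s.y m - algebraMap ℝ A (1/2) * (s.al * s.F * algebraMap ℝ A (s.ai i m))
   + algebraMap ℝ A (1/2) * (s.al * (algebraMap ℝ A (s.bu i) * s.y m + algebraMap ℝ A (s.bu m) * s.y i))

theorem W_eq (i m : Fin n) : s.W i m = s.z * s.Vm m * s.y i + s.Sm i m := by
  have g3 := s.zF
  have k1 : s.z ^ 3 * s.F * s.F = s.z := by linear_combination s.z * (s.z * s.F + 1) * g3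
  have k2 : s.z ^ 3 * s.F * s.F * s.F= 1 := by rw [k1, g3]
  rw [W, Vm, Sm, M]
  generalize algebraMap ℝ A (1/2) = h
  linear_combination (- h * (s.al * s.F * algebraMap ℝ A (s.ai i m)
    - s.al * (algebraMap ℝ A (s.bu i) * s.y m + algebraMap ℝ A (s.bu m) * s.y i))) * k2
    - h * s.Ap * s.y i * s.y m * k1

theorem hVm (m : Fin n) : s.Vm m ∈ s.R := neg_mem (mul_mem (mul_mem (s.hC _) s.hAp) (s.hy m))
theorem hSm (i m : Fin n) : s.Sm i m ∈ s.R := by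
  have := s.hy i
  have := s.hy m
  have := s.hal
  have := s.hF
  have := s.hC (1/2)
  have := s.hC (s.bu i)
  have := s.hC (s.bu m)
  have := s.hC (s.ai i m)
  unfold Sm
  repeat' first | assumption | apply add_mem | apply sub_mem | apply mul_mem

theorem Eu_Vm (m : Fin n) : s.Eu (s.Vm m) = 2 * s.Vm m := by
  simp only [Vm, map_neg, Derivation.leibniz, Eu_C, Eu_Ap, Eu_y, smul_eq_mul]; ring
theorem Eu_Sm (i m : Fin n) : s.Eu (s.Sm i m) = 2 * s.Sm i m := by
  simp only [Sm, map_add, map_sub, Derivation.leibniz, Eu_C, Eu_al, Eu_F, Eu_y, smul_eq_mul]; ring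

theorem sum_DF_Sm (m : Fin n) : ∑ j, s.D j s.F * s.Sm j m =
    - s.Vm m + s.F * (s.y m - algebraMap ℝ A (1/2) * s.y m) := by
  have e : ∀ j, s.D j s.F * s.Sm j m = s.y m * (s.D j s.F * s.y j)
     - algebraMap ℝ A (1/2) * s.al * s.F * (algebraMap ℝ A (s.ai m j) * s.D j s.F)
     + algebraMap ℝ A (1/2) * s.al * s.y m * (algebraMap ℝ A (s.bu j) * s.D j s.F)
     + algebraMap ℝ A (1/2) * s.al * algebraMap ℝ A (s.bu m) * (s.D j s.F * s.y j) := by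
    intro j; rw [Sm, s.aisymm j m]; ring
  simp only [e, Finset.sum_add_distrib, Finset.sum_sub_distrib, ← Finset.mul_sum, sum_DF_y,
    sum_ai_DF]
  rw [Vm]
  linear_combination (algebraMap ℝ A (1/2) * s.y m) * s.sum_bu_DF
    - algebraMap ℝ A (1/2) * s.F * s.y m * s.al_ali

noncomputable def G (c : Fin n → ℝ) (i : Fin n) : A := ∑ m, algebraMap ℝ A (c m) * s.W i m

noncomputable def Ric (c : Fin n → ℝ) (h : Fin n → Fin n → ℝ) : A :=
  2 * (∑ k, ∑ m, algebraMap ℝ A (h m k) * s.W k m)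
  - (∑ k, ∑ j, (∑ m, algebraMap ℝ A (h m j) * s.D k (s.W k m)) * s.y j)
  + (2 * (∑ m, ∑ j, s.G c j * s.D j (s.D m (s.G c m)))
     - (∑ m, ∑ j, s.D j (s.G c m) * s.D m (s.G c j)))

theorem Ric_eq (c : Fin n → ℝ) (h : Fin n → Fin n → ℝ) :
    ∃ q ∈ s.R, s.Ric c h = s.z ^ 2 * (3 * ((n : A) - 1) *
      (algebraMap ℝ A (1/2) * s.Ap * s.lin c) ^ 2) + s.z * q := by
  set V := ∑ m, algebraMap ℝ A (c m) * s.Vm m with hVd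
  set S : Fin n → A := fun i => ∑ m, algebraMap ℝ A (c m) * s.Sm i m with hSd
  have hV : V ∈ s.R := sum_mem fun m _ => mul_mem (s.hC _) (s.hVm m)
  have hS : ∀ i, S i ∈ s.R := fun i => sum_mem fun m _ => mul_mem (s.hC _) (s.hSm i m)
  have hV2 : V = - (algebraMap ℝ A (1/2) * s.Ap * s.lin c) := by
    rw [hVd, lin, Finset.mul_sum, ← Finset.sum_neg_distrib]
    exact Finset.sum_congr rfl fun m _ => by rw [Vm]; ring
  have hG : ∀ i, s.G c i = s.z * V * s.y i + S i := by
    intro i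
    rw [G, hVd, hSd, Finset.mul_sum, Finset.sum_mul, ← Finset.sum_add_distrib]
    exact Finset.sum_congr rfl fun m _ => by rw [W_eq]; ring
  have EV : s.Eu V = 2 * V := by
    rw [hVd, map_sum, Finset.mul_sum]
    refine Finset.sum_congr rfl fun m _ => ?_
    rw [Derivation.leibniz, Eu_C, Eu_Vm, smul_eq_mul, smul_eq_mul]; ring
  have ES : ∀ i, s.Eu (S i) = 2 * S i := by
    intro i
    rw [hSd, map_sum, Finset.mul_sum]
    refine Finset.sum_congr rfl fun m _ => ?_
    rw [Derivation.leibniz, Eu_C, Eu_Sm, smul_eq_mul, smul_eq_mul]; ring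
  have hFS : ∑ j, s.D j s.F * S j = - V + s.F * (∑ m, algebraMap ℝ A (c m) *
      (s.y m - algebraMap ℝ A (1/2) * s.y m)) := by
    simp only [hSd, Finset.mul_sum, hVd]
    rw [Finset.sum_comm, ← Finset.sum_neg_distrib, ← Finset.sum_add_distrib]
    refine Finset.sum_congr rfl fun m _ => ?_
    rw [show ∑ j, s.D j s.F * (algebraMap ℝ A (c m) * s.Sm j m) =
      algebraMap ℝ A (c m) * ∑ j, s.D j s.F * s.Sm j m by
      rw [Finset.mul_sum]; exact Finset.sum_congr rfl fun j _ => by ring, sum_DF_Sm]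
    ring
  have hu : ∑ m, algebraMap ℝ A (c m) * (s.y m - algebraMap ℝ A (1/2) * s.y m) ∈ s.R :=
    sum_mem fun m _ => mul_mem (s.hC _) (sub_mem (s.hy m) (mul_mem (s.hC _) (s.hy m)))
  obtain ⟨q1, hq1, e1⟩ := s.ricq V _ S hV hu hS EV ES hFS
  have hWI : ∀ i m, s.W i m ∈ s.I 1 := by
    intro i m
    rw [W_eq]
    refine add_mem ⟨s.Vm m * s.y i, mul_mem (s.hVm m) (s.hy i), by ring⟩ ?_
    exact s.I_le (Nat.zero_le 1) (s.I_zero (s.hSm i m))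
  have hDW : ∀ m, ∑ k, s.D k (s.W k m) ∈ s.I 1 := by
    intro m
    have hp : s.Eu (s.z * s.Vm m) = s.z * s.Vm m := by
      rw [Derivation.leibniz, Eu_Vm, s.Eu_z, smul_eq_mul, smul_eq_mul]; ring
    simp only [W_eq]
    rw [s.Div_eq _ (fun k => s.Sm k m) hp]
    refine add_mem ?_ ?_
    · exact ⟨((n : A) + 1) * s.Vm m, mul_mem (add_mem (natCast_mem _ n) (one_mem _)) (s.hVm m),
        by ring⟩
    · exact s.I_le (Nat.zero_le 1) (s.I_zero (sum_mem fun k _ => s.hD _ _ (s.hSm k m)))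
  have h1 : 2 * (∑ k, ∑ m, algebraMap ℝ A (h m k) * s.W k m)
      - (∑ k, ∑ j, (∑ m, algebraMap ℝ A (h m j) * s.D k (s.W k m)) * s.y j) ∈ s.I 1 := by
    refine sub_mem (s.I_Rmul (ofNat_mem _ 2) (sum_mem fun k _ => sum_mem fun m _ =>
      s.I_Rmul (s.hC _) (hWI _ _))) ?_
    have : ∑ k, ∑ j, (∑ m, algebraMap ℝ A (h m j) * s.D k (s.W k m)) * s.y j =
        ∑ j, ∑ m, (s.y j * algebraMap ℝ A (h m j)) * ∑ k, s.D k (s.W k m) := by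
      rw [Finset.sum_comm]
      refine Finset.sum_congr rfl fun j _ => ?_
      simp only [Finset.mul_sum, Finset.sum_mul]
      rw [Finset.sum_comm]
      exact Finset.sum_congr rfl fun m _ => Finset.sum_congr rfl fun k _ => by ring
    rw [this]
    exact sum_mem fun j _ => sum_mem fun m _ =>
      s.I_Rmul (mul_mem (s.hy j) (s.hC _)) (hDW m)
  obtain ⟨q2, hq2, e2⟩ := h1
  refine ⟨q1 + q2, add_mem hq1 hq2, ?_⟩
  rw [Ric, e2]
  simp only [hG]
  rw [hV2] at e1 ⊢
  linear_combination e1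

theorem main_contr (c : Fin n → ℝ) (h : Fin n → Fin n → ℝ) :
    ∃ r ∈ s.R, ∑ i, ∑ j, s.M i j * s.D i (s.D j (s.Ric c h)) =
      12 * s.z ^ 5 * s.Ap * (3 * ((n : A) - 1) *
      (algebraMap ℝ A (1/2) * s.Ap * s.lin c) ^ 2) + s.z ^ 4 * r := by
  obtain ⟨q, hq, e⟩ := s.Ric_eq c h
  rw [e]
  have hl := s.hlin c
  refine s.final_contr _ q ?_ hq ?_
  · exact mul_mem (mul_mem (ofNat_mem _ 3) (sub_mem (natCast_mem _ n) (one_mem _)))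
      (pow_mem (mul_mem (mul_mem (s.hC _) s.hAp) hl) 2)
  · simp only [pow_two, Derivation.leibniz, Eu_C, Eu_Ap, Eu_lin, smul_eq_mul, map_sub,
      show s.Eu (3 : A) = 0 from s.Eu.map_natCast 3, s.Eu.map_natCast n, s.Eu.map_one_eq_zero]
    ring

end RD


/-! ### Smooth functions on the slit space -/

abbrev Om (n : ℕ) := {y : Vec n // y ≠ 0}

open Classical in
def extz {n : ℕ} (f : Om n → ℝ) : Vec n → ℝ := fun y => if h : y ≠ 0 then f ⟨y, h⟩ else 0

theorem extz_apply {n : ℕ} (f : Om n → ℝ) {y : Vec n} (h : y ≠ 0) : extz f y = f ⟨y, h⟩ := by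
  simp [extz, h]

theorem isOpen_slit (n : ℕ) : IsOpen {y : Vec n | y ≠ 0} := isOpen_ne

def SmR (n : ℕ) : Subalgebra ℝ (Om n → ℝ) where
  carrier := {f | ContDiffOn ℝ (⊤ : ℕ∞) (extz f) {y : Vec n | y ≠ 0}}
  mul_mem' := by
    intro f g hf hg
    refine (hf.mul hg).congr fun y hy => ?_
    simp [extz_apply _ hy]
  add_mem' := by
    intro f g hf hg
    refine (hf.add hg).congr fun y hy => ?_
    simp [extz_apply _ hy]
  algebraMap_mem' := by
    intro r
    refine (contDiffOn_const (c := r)).congr fun y hy => ?_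
    simp [extz_apply _ hy]

theorem pd_congr {n : ℕ} {f g : Vec n → ℝ} {U : Set (Vec n)} (hU : IsOpen U) {y : Vec n}
    (hy : y ∈ U) (h : ∀ z ∈ U, f z = g z) (i : Fin n) : pd i f y = pd i g y := by
  have : f =ᶠ[nhds y] g := Filter.eventuallyEq_of_mem (hU.mem_nhds hy) h
  rw [pd, pd, this.fderiv_eq]

theorem contDiffOn_pd {n : ℕ} {f : Vec n → ℝ} {U : Set (Vec n)} (hU : IsOpen U)
    (hf : ContDiffOn ℝ (⊤ : ℕ∞) f U) (i : Fin n) : ContDiffOn ℝ (⊤ : ℕ∞) (pd i f) U := by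
  have h := (contDiffOn_infty_iff_fderiv_of_isOpen hU).1 hf
  exact h.2.clm_apply contDiffOn_const

theorem diffAt {n : ℕ} {f : Vec n → ℝ} {U : Set (Vec n)} (hU : IsOpen U)
    (hf : ContDiffOn ℝ (⊤ : ℕ∞) f U) {y : Vec n} (hy : y ∈ U) : DifferentiableAt ℝ f y :=
  (hf.contDiffAt (hU.mem_nhds hy)).differentiableAt (by simp)

/-- make an element -/
def toSm {n : ℕ} (f : Vec n → ℝ) (hf : ContDiffOn ℝ (⊤ : ℕ∞) f {y : Vec n | y ≠ 0}) : SmR n :=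
  ⟨fun y => f y, hf.congr fun y hy => by simp [extz_apply _ hy]⟩

def DD {n : ℕ} (i : Fin n) : Derivation ℝ (SmR n) (SmR n) :=
  Derivation.mk'
    { toFun := fun f => toSm (pd i (extz f.1)) (contDiffOn_pd (isOpen_slit n) f.2 i)
      map_add' := by
        intro f g
        ext y
        change pd i (extz (f.1 + g.1)) y = pd i (extz f.1) y + pd i (extz g.1) y
        rw [pd_congr (isOpen_slit n) (y := y.1) y.2 (g := extz f.1 + extz g.1)]
        · rw [pd, fderiv_add (diffAt (isOpen_slit n) f.2 y.2) (diffAt (isOpen_slit n) g.2 y.2)]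
          rfl
        · intro z hz; simp [extz_apply _ hz]
      map_smul' := by
        intro r f
        ext y
        change pd i (extz (r • f.1)) y = r * pd i (extz f.1) y
        rw [pd_congr (isOpen_slit n) (y := y.1) y.2 (g := r • extz f.1)]
        · rw [pd, fderiv_const_smul (diffAt (isOpen_slit n) f.2 y.2)]
          rfl
        · intro z hz; simp [extz_apply _ hz] }
    (by
        intro f g
        ext y
        change pd i (extz (f.1 * g.1)) y = f.1 y * pd i (extz g.1) y + g.1 y * pd i (extz f.1) y
        rw [pd_congr (isOpen_slit n) (y := y.1) y.2 (g := extz f.1 * extz g.1)]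
        · rw [pd, fderiv_mul (diffAt (isOpen_slit n) f.2 y.2) (diffAt (isOpen_slit n) g.2 y.2)]
          simp [pd, extz_apply _ y.2]
        · intro z hz; simp [extz_apply _ hz])

theorem DD_apply {n : ℕ} (i : Fin n) (f : SmR n) (y : Om n) :
    (DD i f).1 y = pd i (extz f.1) y.1 := rfl

/-- evaluation -/
def evH {n : ℕ} (y : Om n) : SmR n →ₐ[ℝ] ℝ := (Pi.evalAlgHom ℝ (fun _ : Om n => ℝ) y).comp (SmR n).val

theorem evH_apply {n : ℕ} (y : Om n) (f : SmR n) : evH y f = f.1 y := rfl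

theorem evH_toSm {n : ℕ} (y : Om n) (f : Vec n → ℝ) (hf) : evH y (toSm f hf) = f y.1 := rfl

theorem sm_ext {n : ℕ} {f g : SmR n} (h : ∀ y, evH y f = evH y g) : f = g := by
  ext y; exact h y

theorem pd_eq_ev {n : ℕ} (i : Fin n) (f : Vec n → ℝ) (g : SmR n)
    (h : ∀ y : Om n, f y.1 = evH y g) (y : Om n) : pd i f y.1 = evH y (DD i g) := by
  rw [evH_apply, DD_apply]
  exact pd_congr (isOpen_slit n) y.2 (fun z hz => by rw [extz_apply _ hz]; exact h ⟨z, hz⟩) i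

theorem quad_pos {n : ℕ} {a : Matrix (Fin n) (Fin n) ℝ} (ha : a.PosDef) {y : Vec n} (hy : y ≠ 0) :
    0 < ∑ i, ∑ j, a i j * y i * y j := by
  have := ha.dotProduct_mulVec_pos hy
  simp only [dotProduct, mulVec, Finset.mul_sum] at this
  refine this.trans_eq ?_
  refine Finset.sum_congr rfl fun i _ => Finset.sum_congr rfl fun j _ => ?_
  simp; ring

def coordS {n : ℕ} (i : Fin n) : SmR n := toSm (fun y => y i) (by fun_prop)

def alS {n : ℕ} (a : Matrix (Fin n) (Fin n) ℝ) (ha : a.PosDef) : SmR n :=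
  toSm (fun y => Real.sqrt (∑ i, ∑ j, a i j * y i * y j))
    (ContDiffOn.sqrt (by fun_prop) fun y hy => (quad_pos ha hy).ne')

def aliS {n : ℕ} (a : Matrix (Fin n) (Fin n) ℝ) (ha : a.PosDef) : SmR n :=
  toSm (fun y => (Real.sqrt (∑ i, ∑ j, a i j * y i * y j))⁻¹)
    ((ContDiffOn.sqrt (by fun_prop) fun y hy => (quad_pos ha hy).ne').inv
      fun y hy => (Real.sqrt_pos.2 (quad_pos ha hy)).ne')

def zS {n : ℕ} (a : Matrix (Fin n) (Fin n) ℝ) (ha : a.PosDef) (b : Vec n)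
    (hpos : ∀ y : Vec n, y ≠ 0 → 0 < Real.sqrt (∑ i, ∑ j, a i j * y i * y j) + ∑ i, b i * y i) :
    SmR n :=
  toSm (fun y => (Real.sqrt (∑ i, ∑ j, a i j * y i * y j) + ∑ i, b i * y i)⁻¹)
    (((ContDiffOn.sqrt (by fun_prop) fun y hy => (quad_pos ha hy).ne').add (by fun_prop)).inv
      fun y hy => (hpos y hy).ne')

def genS {n : ℕ} (a : Matrix (Fin n) (Fin n) ℝ) (ha : a.PosDef) : Set (SmR n) :=
  Set.range coordS ∪ {alS a ha, aliS a ha}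

theorem DD_coord {n : ℕ} (i j : Fin n) : DD i (coordS j : SmR n) = if i = j then 1 else 0 := by
  apply sm_ext
  intro y
  rw [← pd_eq_ev i (fun y => y j) (coordS j) (fun y => rfl), pd]
  have : fderiv ℝ (fun y : Vec n => y j) y.1 = ContinuousLinearMap.proj j :=
    (ContinuousLinearMap.proj (R := ℝ) (φ := fun _ : Fin n => ℝ) j).fderiv
  rw [this]
  by_cases h : i = j
  · subst h; simp
  · simp [h, Ne.symm h]

theorem al_ali_S {n : ℕ} (a : Matrix (Fin n) (Fin n) ℝ) (ha : a.PosDef) :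
    alS a ha * aliS a ha = 1 := by
  apply sm_ext
  intro y
  rw [map_mul, map_one, alS, aliS, evH_toSm, evH_toSm]
  exact mul_inv_cancel₀ (Real.sqrt_pos.2 (quad_pos ha y.2)).ne'

theorem alsq_S {n : ℕ} (a : Matrix (Fin n) (Fin n) ℝ) (ha : a.PosDef) :
    alS a ha * alS a ha = ∑ i, ∑ j, algebraMap ℝ (SmR n) (a i j) * coordS i * coordS j := by
  apply sm_ext
  intro y
  simp only [map_mul, map_sum, AlgHom.commutes]
  rw [alS, evH_toSm, Real.mul_self_sqrt (quad_pos ha y.2).le]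
  rfl

theorem D_al_S {n : ℕ} (a : Matrix (Fin n) (Fin n) ℝ) (ha : a.PosDef) (k : Fin n) :
    DD k (alS a ha) = algebraMap ℝ (SmR n) (1/2) * aliS a ha *
      ∑ i, ∑ j, algebraMap ℝ (SmR n) (a i j) * ((if k = i then 1 else 0) * coordS j
        + coordS i * (if k = j then 1 else 0)) := by
  have h := congrArg (DD k) (alsq_S a ha)
  have h2 : DD k (∑ i, ∑ j, algebraMap ℝ (SmR n) (a i j) * coordS i * coordS j) =
    ∑ i, ∑ j, algebraMap ℝ (SmR n) (a i j) * ((if k = i then 1 else 0) * coordS j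
        + coordS i * (if k = j then 1 else 0)) := by
    simp only [map_sum]
    refine Finset.sum_congr rfl fun i _ => Finset.sum_congr rfl fun j _ => ?_
    simp only [Derivation.leibniz, DD_coord, Derivation.map_algebraMap, smul_eq_mul]
    ring
  rw [← h2, ← h, Derivation.leibniz, smul_eq_mul]
  have h3 : algebraMap ℝ (SmR n) (1/2) * 2 = 1 := by
    rw [show (2 : SmR n) = algebraMap ℝ (SmR n) 2 from (map_ofNat (algebraMap ℝ _) 2).symm,
      ← map_mul]
    norm_num
  linear_combination (- DD k (alS a ha)) * h3
    - algebraMap ℝ (SmR n) (1/2) * 2 * DD k (alS a ha) * al_ali_S a ha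

theorem D_ali_S {n : ℕ} (a : Matrix (Fin n) (Fin n) ℝ) (ha : a.PosDef) (k : Fin n) :
    DD k (aliS a ha) = - (aliS a ha * aliS a ha * DD k (alS a ha)) := by
  have h := congrArg (DD k) (al_ali_S a ha)
  rw [Derivation.leibniz, smul_eq_mul, smul_eq_mul, Derivation.map_one_eq_zero] at h
  linear_combination aliS a ha * h - DD k (aliS a ha) * al_ali_S a ha

theorem hD_S {n : ℕ} (a : Matrix (Fin n) (Fin n) ℝ) (ha : a.PosDef) (k : Fin n) (f : SmR n)
    (hf : f ∈ Algebra.adjoin ℝ (genS a ha)) : DD k f ∈ Algebra.adjoin ℝ (genS a ha) := by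
  have hc : ∀ i, (coordS i : SmR n) ∈ Algebra.adjoin ℝ (genS a ha) := fun i =>
    Algebra.subset_adjoin (Or.inl ⟨i, rfl⟩)
  have hal : alS a ha ∈ Algebra.adjoin ℝ (genS a ha) :=
    Algebra.subset_adjoin (Or.inr (Or.inl rfl))
  have hali : aliS a ha ∈ Algebra.adjoin ℝ (genS a ha) :=
    Algebra.subset_adjoin (Or.inr (Or.inr rfl))
  have hite : ∀ i, (if k = i then (1 : SmR n) else 0) ∈ Algebra.adjoin ℝ (genS a ha) := by
    intro i; split_ifs
    · exact one_mem _
    · exact zero_mem _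
  have hDal : DD k (alS a ha) ∈ Algebra.adjoin ℝ (genS a ha) := by
    rw [D_al_S]
    exact mul_mem (mul_mem (Subalgebra.algebraMap_mem _ _) hali)
      (sum_mem fun i _ => sum_mem fun j _ => mul_mem (Subalgebra.algebraMap_mem _ _)
        (add_mem (mul_mem (hite _) (hc _)) (mul_mem (hc _) (hite _))))
  induction hf using Algebra.adjoin_induction with
  | mem x hx =>
    rcases hx with ⟨i, rfl⟩ | rfl | rfl
    · rw [DD_coord]; exact hite i
    · exact hDal
    · rw [D_ali_S]; exact neg_mem (mul_mem (mul_mem hali hali) hDal)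
  | algebraMap r => rw [Derivation.map_algebraMap]; exact zero_mem _
  | add x y _ _ hx hy => rw [map_add]; exact add_mem hx hy
  | mul x y hx' hy' hx hy =>
    rw [Derivation.leibniz]; exact add_mem (mul_mem hx' hy) (mul_mem hy' hx)

def mkRD {n : ℕ} (a : Matrix (Fin n) (Fin n) ℝ) (hs : a.IsSymm) (ha : a.PosDef) (b : Vec n)
    (hpos : ∀ y : Vec n, y ≠ 0 → 0 < Real.sqrt (∑ i, ∑ j, a i j * y i * y j) + ∑ i, b i * y i) :
    RD n (SmR n) where
  D := DD
  R := Algebra.adjoin ℝ (genS a ha)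
  hD := hD_S a ha
  y := coordS
  hy := fun i => Algebra.subset_adjoin (Or.inl ⟨i, rfl⟩)
  Dy := DD_coord
  al := alS a ha
  ali := aliS a ha
  hal := Algebra.subset_adjoin (Or.inr (Or.inl rfl))
  hali := Algebra.subset_adjoin (Or.inr (Or.inr rfl))
  al_ali := al_ali_S a ha
  a := a
  ai := fun i j => (a⁻¹ : Matrix (Fin n) (Fin n) ℝ) i j
  b := b
  asymm := fun i j => (hs.apply i j).symm
  aisymm := fun i j => by
    have : (a⁻¹)ᵀ = a⁻¹ := by rw [Matrix.transpose_nonsing_inv, hs.eq]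
    exact congrFun (congrFun this j) i
  ainv := fun i k => by
    have : a * a⁻¹ = 1 := Matrix.mul_nonsing_inv a ha.det_pos.ne'.isUnit
    have := congrFun (congrFun this i) k
    rwa [Matrix.mul_apply, Matrix.one_apply] at this
  alsq := alsq_S a ha
  z := zS a ha b hpos
  hz := by
    apply sm_ext
    intro y
    simp only [map_mul, map_add, map_sum, map_one, AlgHom.commutes]
    exact inv_mul_cancel₀ (hpos _ y.2).ne'


/-! ### Plumbing: the geometric quantities in terms of the algebraic model -/

section plumbing
variable {n : ℕ} {U : Set (Vec n)} {F : Vec n → Vec n → ℝ} {k : Vec n → ℝ} (s : RD n (SmR n))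

theorem pl_dyF2 (hD : s.D = DD)
    (hF : ∀ x ∈ U, ∀ y : Om n, F x y.1 = Real.exp (k x) * evH y s.F)
    {x : Vec n} (hx : x ∈ U) (y : Om n) (l : Fin n) :
    dy l (F2 F) x y.1 = Real.exp (2 * k x) * evH y (s.D l (s.F ^ 2)) := by
  rw [dy, pd_eq_ev l (F2 F x) (algebraMap ℝ _ (Real.exp (2 * k x)) * s.F ^ 2), hD]
  · rw [Derivation.leibniz]
    simp
  · intro y
    rw [F2, hF x hx y, map_mul, AlgHom.commutes, map_pow, two_mul, Real.exp_add]
    simp; ring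

theorem pl_gmat (hD : s.D = DD)
    (hF : ∀ x ∈ U, ∀ y : Om n, F x y.1 = Real.exp (k x) * evH y s.F)
    {x : Vec n} (hx : x ∈ U) (y : Om n) (i j : Fin n) :
    gmat F x y.1 i j = Real.exp (2 * k x) *
      evH y (s.D i s.F * s.D j s.F + s.F * s.D i (s.D j s.F)) := by
  rw [gmat, Matrix.of_apply, dy, pd_eq_ev i _
    (algebraMap ℝ _ (Real.exp (2 * k x)) * s.D j (s.F ^ 2)), ← hD]
  · rw [Derivation.leibniz, Derivation.map_algebraMap, s.half_DD]
    have h2 : evH y (2 : SmR n) = 2 := map_ofNat (evH y) 2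
    simp [h2]
    ring
  · intro y
    rw [pl_dyF2 s hD hF hx, map_mul, AlgHom.commutes]
    simp

theorem pl_ginv (hD : s.D = DD)
    (hF : ∀ x ∈ U, ∀ y : Om n, F x y.1 = Real.exp (k x) * evH y s.F)
    {x : Vec n} (hx : x ∈ U) (y : Om n) (i j : Fin n) :
    ginv F x y.1 i j = Real.exp (- (2 * k x)) * evH y (s.M i j) := by
  have : gmat F x y.1 * (Matrix.of fun i j => Real.exp (- (2 * k x)) * evH y (s.M i j)) = 1 := by
    ext i l
    have h := congrArg (evH y) (s.g_M i l)
    rw [map_sum] at h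
    rw [Matrix.mul_apply, Matrix.one_apply]
    simp only [pl_gmat s hD hF hx, Matrix.of_apply]
    have h2 : (if i = l then (1 : ℝ) else 0) = evH y (if i = l then 1 else 0) := by
      split_ifs <;> simp
    rw [h2, ← h]
    refine Finset.sum_congr rfl fun j _ => ?_
    rw [map_mul (evH y) _ (s.M j l), Real.exp_neg]
    field_simp
  rw [ginv, Matrix.inv_eq_right_inv this, Matrix.of_apply]

theorem pd_exp (hU : IsOpen U) (hk : ContDiffOn ℝ (⊤ : ℕ∞) k U) {x : Vec n} (hx : x ∈ U)
    (C : ℝ) (m : Fin n) :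
    pd m (fun x' => Real.exp (2 * k x') * C) x = 2 * pd m k x * Real.exp (2 * k x) * C := by
  have h1 := (diffAt hU hk hx).hasFDerivAt
  have h2 := ((h1.const_mul 2).exp).mul_const C
  rw [pd, h2.fderiv]
  simp [pd]
  ring

theorem pl_Geo (hD : s.D = DD) (hsy : s.y = coordS) (hU : IsOpen U) (hk : ContDiffOn ℝ (⊤ : ℕ∞) k U)
    (hF : ∀ x ∈ U, ∀ y : Om n, F x y.1 = Real.exp (k x) * evH y s.F)
    {x : Vec n} (hx : x ∈ U) (y : Om n) (i : Fin n) :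
    Geo F i x y.1 = evH y (s.G (fun m => pd m k x) i) := by
  have e1 : ∀ m l, dx m (fun x' y' => dy l (F2 F) x' y') x y.1 =
      2 * pd m k x * Real.exp (2 * k x) * evH y (s.D l (s.F ^ 2)) := by
    intro m l
    rw [dx, pd_congr hU hx (fun x' hx' => pl_dyF2 s hD hF hx' y l), pd_exp hU hk hx]
  have e2 : ∀ l, dx l (F2 F) x y.1 = 2 * pd l k x * Real.exp (2 * k x) * evH y (s.F ^ 2) := by
    intro l
    rw [dx, ← pd_exp hU hk hx]
    refine pd_congr hU hx (fun x' hx' => ?_) l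
    rw [F2, hF x' hx' y, map_pow, two_mul, Real.exp_add]
    ring
  have ey : ∀ m, y.1 m = evH y (s.y m) := by intro m; rw [hsy]; rfl
  have hM : ∑ l, evH y (s.M i l) * evH y (s.D l s.F) = evH y (s.z * s.y i) := by
    rw [← s.sum_DF_M i, map_sum]
    exact Finset.sum_congr rfl fun l _ => by rw [s.M_symm, map_mul]; ring
  have hz : evH y s.z * evH y s.F = 1 := by rw [← map_mul, s.zF, map_one]
  rw [Geo]
  simp only [e1, e2, pl_ginv s hD hF hx, ey]
  have e3 : ∀ l, evH y (s.D l (s.F ^ 2)) = 2 * evH y s.F * evH y (s.D l s.F) := by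
    intro l
    rw [pow_two, Derivation.leibniz, smul_eq_mul, map_add, map_mul]; ring
  have e4 : ∀ l, Real.exp (- (2 * k x)) * evH y (s.M i l) *
      ((∑ m, 2 * pd m k x * Real.exp (2 * k x) * evH y (s.D l (s.F ^ 2)) * evH y (s.y m))
        - 2 * pd l k x * Real.exp (2 * k x) * evH y (s.F ^ 2)) =
      (4 * evH y s.F * ∑ m, pd m k x * evH y (s.y m)) * (evH y (s.M i l) * evH y (s.D l s.F))
       - 2 * pd l k x * evH y (s.F ^ 2) * evH y (s.M i l) := by
    intro l
    have : ∑ m, 2 * pd m k x * Real.exp (2 * k x) * evH y (s.D l (s.F ^ 2)) * evH y (s.y m) =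
       2 * Real.exp (2 * k x) * evH y (s.D l (s.F ^ 2)) * ∑ m, pd m k x * evH y (s.y m) := by
      rw [Finset.mul_sum]; exact Finset.sum_congr rfl fun m _ => by ring
    rw [this, e3, Real.exp_neg]
    field_simp
    ring
  simp only [e4, Finset.sum_sub_distrib, ← Finset.mul_sum, hM]
  rw [RD.G, map_sum]
  simp only [map_mul, AlgHom.commutes, RD.W, map_sub, map_pow]
  simp only [mul_sub, Finset.sum_sub_distrib]
  congr 1
  · rw [show (1/4 : ℝ) * (4 * evH y s.F * (∑ m, pd m k x * evH y (s.y m)) *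
      (evH y s.z * evH y (s.y i))) = (evH y s.z * evH y s.F) * (∑ m, pd m k x * evH y (s.y m)) *
      evH y (s.y i) by ring, hz, one_mul, Finset.sum_mul]
    exact Finset.sum_congr rfl fun m _ => by simp; ring
  · rw [Finset.mul_sum]
    exact Finset.sum_congr rfl fun m _ => by simp; ring

theorem pl_dxGeo (hD : s.D = DD) (hsy : s.y = coordS) (hU : IsOpen U)
    (hk : ContDiffOn ℝ (⊤ : ℕ∞) k U)
    (hF : ∀ x ∈ U, ∀ y : Om n, F x y.1 = Real.exp (k x) * evH y s.F)
    {x : Vec n} (hx : x ∈ U) (y : Om n) (i j : Fin n) :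
    dx j (Geo F i) x y.1 = evH y (∑ m, algebraMap ℝ _ (pd j (pd m k) x) * s.W i m) := by
  rw [dx, pd_congr hU hx (fun x' hx' => pl_Geo s hD hsy hU hk hF hx' y i)]
  have e : (fun x' => evH y (s.G (fun m => pd m k x') i)) =
      fun x' => ∑ m, pd m k x' * evH y (s.W i m) := by
    ext x'
    rw [RD.G, map_sum]
    exact Finset.sum_congr rfl fun m _ => by rw [map_mul, AlgHom.commutes]; simp
  rw [e, pd]
  have h : HasFDerivAt (fun x' => ∑ m, pd m k x' * evH y (s.W i m))
      (∑ m, evH y (s.W i m) • fderiv ℝ (pd m k) x) x := by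
    refine HasFDerivAt.fun_sum fun m _ => ?_
    exact (diffAt hU (contDiffOn_pd hU hk m) hx).hasFDerivAt.mul_const _
  rw [h.fderiv, map_sum]
  simp [pd, mul_comm]

theorem pl_Ricci (hD : s.D = DD) (hsy : s.y = coordS) (hU : IsOpen U)
    (hk : ContDiffOn ℝ (⊤ : ℕ∞) k U)
    (hF : ∀ x ∈ U, ∀ y : Om n, F x y.1 = Real.exp (k x) * evH y s.F)
    {x : Vec n} (hx : x ∈ U) (y : Om n) :
    RicciC F x y.1 = evH y (s.Ric (fun m => pd m k x) (fun m j => pd j (pd m k) x)) := by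
  have ey : ∀ m, y.1 m = evH y (s.y m) := by intro m; rw [hsy]; rfl
  have g := fun (y : Om n) i => pl_Geo s hD hsy hU hk hF hx y i
  have g1 : ∀ (y : Om n) i j, dy j (Geo F i) x y.1 =
      evH y (s.D j (s.G (fun m => pd m k x) i)) := by
    intro y i j
    rw [dy, hD]; exact pd_eq_ev _ _ _ (fun y => g y i) y
  have g2 : ∀ (y : Om n) i j l, dy l (fun x' y' => dy j (Geo F i) x' y') x y.1 =
      evH y (s.D l (s.D j (s.G (fun m => pd m k x) i))) := by
    intro y i j l
    rw [dy, hD]; exact pd_eq_ev _ _ _ (fun y => by rw [g1, hD]) y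
  have g3 : ∀ (y : Om n) i j l, dy l (fun x' y' => dx j (Geo F i) x' y') x y.1 =
      evH y (∑ m, algebraMap ℝ _ (pd j (pd m k) x) * s.D l (s.W i m)) := by
    intro y i j l
    rw [dy, pd_eq_ev _ _ _ (fun y => pl_dxGeo s hD hsy hU hk hF hx y i j) y, map_sum, hD]
    congr 1
    exact Finset.sum_congr rfl fun m _ => by
      rw [Derivation.leibniz, Derivation.map_algebraMap]; simp
  simp only [RicciC, Riem, g, g1, g2, g3, ey, pl_dxGeo s hD hsy hU hk hF hx]
  simp only [RD.Ric, Finset.sum_add_distrib, Finset.sum_sub_distrib, ← Finset.mul_sum]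
  simp only [← map_mul, ← map_sum, ← map_sub, ← map_add, ← map_ofNat (evH y) 2]
  congr 1
  ring

theorem pl_scal (hD : s.D = DD) (hsy : s.y = coordS) (hU : IsOpen U)
    (hk : ContDiffOn ℝ (⊤ : ℕ∞) k U)
    (hF : ∀ x ∈ U, ∀ y : Om n, F x y.1 = Real.exp (k x) * evH y s.F)
    {x : Vec n} (hx : x ∈ U) (y : Om n) :
    scalarCurv F x y.1 = Real.exp (- (2 * k x)) * (1/2) * evH y (∑ i, ∑ j, s.M i j *
      s.D i (s.D j (s.Ric (fun m => pd m k x) (fun m j => pd j (pd m k) x)))) := by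
  have g1 : ∀ (y : Om n) j, dy j (RicciC F) x y.1 =
      evH y (s.D j (s.Ric (fun m => pd m k x) (fun m j => pd j (pd m k) x))) := by
    intro y j
    rw [dy, hD]; exact pd_eq_ev _ _ _ (fun y => pl_Ricci s hD hsy hU hk hF hx y) y
  have g2 : ∀ (y : Om n) i j, dy i (fun x' y' => dy j (RicciC F) x' y') x y.1 =
      evH y (s.D i (s.D j (s.Ric (fun m => pd m k x) (fun m j => pd j (pd m k) x)))) := by
    intro y i j
    rw [dy, hD]; exact pd_eq_ev _ _ _ (fun y => by rw [g1, hD]) y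
  simp only [scalarCurv, RicciTensor, g2, pl_ginv s hD hF hx, map_sum, Finset.mul_sum, map_mul]
  exact Finset.sum_congr rfl fun i _ => Finset.sum_congr rfl fun j _ => by ring

end plumbing


/-! ### Restriction to a rational curve -/

theorem poly_conclusion {σ c1 c2 K : ℝ} (h0 : 0 < σ) (h1 : σ < 1) (hK : K ≠ 0) (N : ℕ)
    (p : Polynomial ℝ)
    (h : ∀ t : ℝ, K * (σ * ((σ + 1) + (σ - 1) * t ^ 2)) ^ 3 * (c1 * (1 - t ^ 2) + c2 * (2 * t)) ^ 2
      * (1 + t ^ 2) ^ N = ((1 + σ) + (1 - σ) * t ^ 2) * p.eval t) : c1 = 0 ∧ c2 = 0 := by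
  open Polynomial in
  have hp : (C K * (C σ * (C (σ + 1) + C (σ - 1) * X ^ 2)) ^ 3 *
      (C c1 * (1 - X ^ 2) + C c2 * (C 2 * X)) ^ 2 * (1 + X ^ 2) ^ N : Polynomial ℝ) =
      (C (1 + σ) + C (1 - σ) * X ^ 2) * p := by
    apply Polynomial.funext
    intro t
    have := h t
    simp only [eval_mul, eval_pow, eval_add, eval_sub, eval_C, eval_X, eval_one]
    exact this
  set τ := Real.sqrt ((1 + σ) / (1 - σ)) with hτ
  have hpos : 0 < (1 + σ) / (1 - σ) := div_pos (by linarith) (by linarith)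
  have hτ0 : 0 < τ := Real.sqrt_pos.2 hpos
  have hτ2 : τ ^ 2 * (1 - σ) = 1 + σ := by
    rw [hτ, Real.sq_sqrt hpos.le]; field_simp [show (1 - σ) ≠ 0 by linarith]
  have hp2 := congrArg (Polynomial.aeval ((τ : ℂ) * Complex.I)) hp
  simp only [map_mul, map_pow, map_add, map_sub, Polynomial.aeval_C, Polynomial.aeval_X,
    map_one, mul_pow, Complex.I_sq] at hp2
  simp only [Complex.coe_algebraMap] at hp2
  have hτC : (τ : ℂ) ^ 2 * (1 - σ) = 1 + σ := by exact_mod_cast hτ2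
  have hz : (1 : ℂ) + σ + (1 - σ) * (τ ^ 2 * -1) = 0 := by linear_combination - hτC
  rw [hz, zero_mul] at hp2
  have hσC : (σ : ℂ) ≠ 0 := by exact_mod_cast h0.ne'
  have hKC : (K : ℂ) ≠ 0 := by exact_mod_cast hK
  have hA : (σ : ℂ) + 1 + (σ - 1) * (τ ^ 2 * -1) ≠ 0 := by
    have : (σ : ℂ) + 1 + (σ - 1) * (τ ^ 2 * -1) = ((2 * (1 + σ) : ℝ) : ℂ) := by
      push_cast; linear_combination hτC
    rw [this]; exact_mod_cast (by linarith : 2 * (1 + σ) ≠ 0)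
  have hτ1 : 1 < τ ^ 2 := by nlinarith
  have hB : (1 : ℂ) + τ ^ 2 * -1 ≠ 0 := by
    have : (1 : ℂ) + τ ^ 2 * -1 = ((1 - τ ^ 2 : ℝ) : ℂ) := by push_cast; ring
    rw [this]; exact_mod_cast (by linarith : 1 - τ ^ 2 ≠ 0)
  have hL : (c1 : ℂ) * (1 - τ ^ 2 * -1) + c2 * ((2 : ℝ) * (τ * Complex.I)) = 0 := by
    by_contra hne
    apply (mul_ne_zero (mul_ne_zero (mul_ne_zero hKC
      (mul_ne_zero (pow_ne_zero 3 hσC) (pow_ne_zero 3 hA))) (pow_ne_zero 2 hne))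
      (pow_ne_zero N hB))
    exact hp2
  have hL2 : (c1 : ℂ) * (1 - τ ^ 2 * -1) + c2 * ((2 : ℝ) * (τ * Complex.I)) =
     ((c1 * (1 + τ ^ 2) : ℝ) : ℂ) + ((2 * c2 * τ : ℝ) : ℂ) * Complex.I := by push_cast; ring
  rw [hL2] at hL
  have hre := congrArg Complex.re hL
  have him := congrArg Complex.im hL
  rw [Complex.add_re, Complex.ofReal_re, Complex.re_ofReal_mul, Complex.I_re] at hre
  rw [Complex.add_im, Complex.ofReal_im, Complex.im_ofReal_mul, Complex.I_im] at him
  simp at hre him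
  constructor
  · rcases hre with h | h
    · exact h
    · nlinarith
  · rcases him with h | h
    · exact h
    · linarith

theorem curve_poly {n : ℕ} (a : Matrix (Fin n) (Fin n) ℝ) (ha : a.PosDef) (Y : ℝ → Om n)
    (hY : ∀ i, ∃ p : Polynomial ℝ, ∀ t, (Y t).1 i = p.eval t)
    (hal : ∀ t, evH (Y t) (alS a ha) = 1 + t ^ 2) (f : SmR n)
    (hf : f ∈ Algebra.adjoin ℝ (genS a ha)) :
    ∃ (p : Polynomial ℝ) (N : ℕ), ∀ t, evH (Y t) f * (1 + t ^ 2) ^ N = p.eval t := by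
  induction hf using Algebra.adjoin_induction with
  | mem x hx =>
    rcases hx with ⟨i, rfl⟩ | rfl | rfl
    · obtain ⟨p, hp⟩ := hY i
      exact ⟨p, 0, fun t => by rw [pow_zero, mul_one, ← hp]; rfl⟩
    · exact ⟨1 + Polynomial.X ^ 2, 0, fun t => by rw [hal]; simp⟩
    · refine ⟨1, 1, fun t => ?_⟩
      rw [← hal, pow_one, ← map_mul, mul_comm, al_ali_S]; simp
  | algebraMap r => exact ⟨Polynomial.C r, 0, fun t => by rw [AlgHom.commutes]; simp⟩
  | add x y _ _ hx hy =>
    obtain ⟨p, N, hp⟩ := hx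
    obtain ⟨q, M, hq⟩ := hy
    refine ⟨p * (1 + Polynomial.X ^ 2) ^ M + q * (1 + Polynomial.X ^ 2) ^ N, N + M, fun t => ?_⟩
    simp only [map_add, Polynomial.eval_add, Polynomial.eval_mul, Polynomial.eval_pow,
      Polynomial.eval_X, Polynomial.eval_one, ← hp, ← hq]
    ring
  | mul x y hx' hy' hx hy =>
    obtain ⟨p, N, hp⟩ := hx
    obtain ⟨q, M, hq⟩ := hy
    refine ⟨p * q, N + M, fun t => ?_⟩
    simp only [map_mul, Polynomial.eval_mul, ← hp, ← hq]
    ring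

def Bf {n : ℕ} (a : Matrix (Fin n) (Fin n) ℝ) (u v : Vec n) : ℝ := ∑ i, ∑ j, a i j * u i * v j

theorem Bf_comb {n : ℕ} (a : Matrix (Fin n) (Fin n) ℝ) (hs : a.IsSymm) (u v : Vec n) (p q : ℝ) :
    Bf a (p • u + q • v) (p • u + q • v) =
      p ^ 2 * Bf a u u + 2 * p * q * Bf a u v + q ^ 2 * Bf a v v := by
  have h1 : Bf a u v = Bf a v u := by
    rw [Bf, Bf, Finset.sum_comm]
    exact Finset.sum_congr rfl fun i _ => Finset.sum_congr rfl fun j _ => by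
      rw [hs.apply]; ring
  have h2 : 2 * p * q * Bf a u v = p * q * Bf a u v + p * q * Bf a v u := by rw [h1]; ring
  rw [h2]
  simp only [Bf, Finset.mul_sum, ← Finset.sum_add_distrib]
  exact Finset.sum_congr rfl fun i _ => Finset.sum_congr rfl fun j _ => by
    simp; ring

section curve
variable {n : ℕ} (a : Matrix (Fin n) (Fin n) ℝ) (hs : a.IsSymm) (ha : a.PosDef) (b : Vec n)
    (hpos : ∀ y : Vec n, y ≠ 0 → 0 < Real.sqrt (∑ i, ∑ j, a i j * y i * y j) + ∑ i, b i * y i)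

theorem curve_concl {e1 e2 c : Vec n} {σ K : ℝ} (h0 : 0 < σ) (h1 : σ < 1) (hK : K ≠ 0)
    (hσ : (mkRD a hs ha b hpos).bb = σ ^ 2)
    (h11 : Bf a e1 e1 = 1) (h12 : Bf a e1 e2 = 0) (h22 : Bf a e2 e2 = 1)
    (hb1 : ∑ i, b i * e1 i = σ) (hb2 : ∑ i, b i * e2 i = 0)
    (r : SmR n) (hr : r ∈ (mkRD a hs ha b hpos).R)
    (h : ∀ y, K * evH y (mkRD a hs ha b hpos).Ap ^ 3 * evH y ((mkRD a hs ha b hpos).lin c) ^ 2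
      = evH y (mkRD a hs ha b hpos).F * evH y r) :
    ∑ i, c i * e1 i = 0 ∧ ∑ i, c i * e2 i = 0 := by
  have hq : ∀ t : ℝ, Bf a ((1 - t ^ 2) • e1 + (2 * t) • e2) ((1 - t ^ 2) • e1 + (2 * t) • e2)
      = (1 + t ^ 2) ^ 2 := by
    intro t; rw [Bf_comb a hs, h11, h12, h22]; ring
  have hne : ∀ t : ℝ, (1 - t ^ 2) • e1 + (2 * t) • e2 ≠ 0 := by
    intro t h0
    have := hq t
    rw [h0] at this
    simp [Bf] at this
    nlinarith [sq_nonneg t]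
  set Y : ℝ → Om n := fun t => ⟨(1 - t ^ 2) • e1 + (2 * t) • e2, hne t⟩ with hYd
  have hlin : ∀ (d : Vec n) t, evH (Y t) ((mkRD a hs ha b hpos).lin d) =
      (∑ i, d i * e1 i) * (1 - t ^ 2) + (∑ i, d i * e2 i) * (2 * t) := by
    intro d t
    rw [RD.lin, map_sum, Finset.sum_mul, Finset.sum_mul, ← Finset.sum_add_distrib]
    refine Finset.sum_congr rfl fun i _ => ?_
    rw [map_mul, AlgHom.commutes]
    change d i * ((1 - t ^ 2) • e1 + (2 * t) • e2) i = _
    simp; ring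
  have hal : ∀ t, evH (Y t) (alS a ha) = 1 + t ^ 2 := by
    intro t
    have := hq t
    rw [alS, evH_toSm]
    change Real.sqrt (Bf a _ _) = _
    rw [this, Real.sqrt_sq (by positivity)]
  have hbe : ∀ t, evH (Y t) (mkRD a hs ha b hpos).be = σ * (1 - t ^ 2) := by
    intro t
    have := hlin b t
    rw [hb1, hb2, zero_mul, add_zero] at this
    exact this
  obtain ⟨p, N, hp⟩ := curve_poly a ha Y (fun i =>
    ⟨(1 - Polynomial.X ^ 2) * Polynomial.C (e1 i) + (Polynomial.C 2 * Polynomial.X) *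
      Polynomial.C (e2 i), fun t => by simp [hYd]⟩) hal r hr
  refine poly_conclusion h0 h1 hK N p fun t => ?_
  have h2 := h (Y t)
  rw [hlin, RD.Ap, RD.F, map_add, map_add, map_mul, AlgHom.commutes, hbe, hσ] at h2
  change K * (σ ^ 2 * evH (Y t) (alS a ha) + _) ^ 3 * _ = (evH (Y t) (alS a ha) + _) * _ at h2
  rw [hal] at h2
  rw [← hp]
  linear_combination (1 + t ^ 2) ^ N * h2

theorem c_zero (hn : 2 ≤ n) (hb : b ≠ 0) {c : Vec n} {K : ℝ} (hK : K ≠ 0)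
    (hb1 : (mkRD a hs ha b hpos).bb < 1)
    (r : SmR n) (hr : r ∈ (mkRD a hs ha b hpos).R)
    (h : ∀ y, K * evH y (mkRD a hs ha b hpos).Ap ^ 3 * evH y ((mkRD a hs ha b hpos).lin c) ^ 2
      = evH y (mkRD a hs ha b hpos).F * evH y r) : c = 0 := by
  set s := mkRD a hs ha b hpos with hsd
  have hBbu : ∀ v : Vec n, Bf a s.bu v = ∑ i, b i * v i := by
    intro v
    have hbi : ∀ j, ∑ i, a i j * s.bu i = b j := by
      intro j
      simp only [RD.bu, Finset.mul_sum]
      rw [Finset.sum_comm]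
      have : ∀ k, ∑ i, a i j * (s.ai i k * s.b k) = (if j = k then 1 else 0) * s.b k := by
        intro k
        rw [← s.ainv j k, Finset.sum_mul]
        exact Finset.sum_congr rfl fun i _ => by
          rw [s.asymm j i]; change s.a i j * _ = _; ring
      simp only [this]
      simp
      rfl
    rw [Bf, Finset.sum_comm]
    exact Finset.sum_congr rfl fun j _ => by rw [← hbi j, Finset.sum_mul]
  have hbb : Bf a s.bu s.bu = s.bb := by
    rw [hBbu, RD.bb]
    exact Finset.sum_congr rfl fun i _ => mul_comm _ _
  have hbu0 : s.bu ≠ 0 := by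
    intro h0
    apply hb
    funext i
    have := hBbu (Pi.single i 1)
    rw [h0] at this
    simp [Bf, Pi.single_apply] at this
    exact this.symm
  have hbbpos : 0 < s.bb := by
    rw [← hbb]; exact quad_pos ha hbu0
  set σ := Real.sqrt s.bb with hσ
  have hσ0 : 0 < σ := Real.sqrt_pos.2 hbbpos
  have hσ2 : s.bb = σ ^ 2 := (Real.sq_sqrt hbbpos.le).symm
  have hσ1 : σ < 1 := by nlinarith
  have hsm : ∀ (u v : Vec n) (p q : ℝ), Bf a (p • u) (q • v) = p * q * Bf a u v := by
    intro u v p q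
    simp only [Bf, Finset.mul_sum]
    exact Finset.sum_congr rfl fun i _ => Finset.sum_congr rfl fun j _ => by simp; ring
  have hls : ∀ (d u : Vec n) (p : ℝ), ∑ i, d i * (p • u) i = p * ∑ i, d i * u i := by
    intro d u p
    rw [Finset.mul_sum]
    exact Finset.sum_congr rfl fun i _ => by simp; ring
  have key : ∀ v : Vec n, v ≠ 0 → ∑ i, b i * v i = 0 →
      ∑ i, c i * s.bu i = 0 ∧ ∑ i, c i * v i = 0 := by
    intro v hv hbv
    have hvp : 0 < Bf a v v := quad_pos ha hv
    have hsv : 0 < Real.sqrt (Bf a v v) := Real.sqrt_pos.2 hvp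
    have hsv2 : Real.sqrt (Bf a v v) ^ 2 = Bf a v v := Real.sq_sqrt hvp.le
    have := curve_concl a hs ha b hpos (e1 := σ⁻¹ • s.bu) (e2 := (Real.sqrt (Bf a v v))⁻¹ • v)
      (c := c) hσ0 hσ1 hK hσ2 (by rw [hsm, hbb, hσ2]; field_simp) (by rw [hsm, hBbu, hbv]; simp)
      (by
        rw [hsm]
        nth_rewrite 3 [← hsv2]
        field_simp)
      (by rw [hls, ← hBbu, hbb, hσ2]; field_simp) (by rw [hls, hbv]; simp) r hr h
    rw [hls, hls] at this
    simpa [hσ0.ne', hsv.ne'] using this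
  have hc1 : ∑ i, c i * s.bu i = 0 := by
    let i0 : Fin n := ⟨0, by omega⟩
    let i1 : Fin n := ⟨1, by omega⟩
    have hi : i0 ≠ i1 := by simp [i0, i1]
    by_cases h0 : b i0 = 0
    · exact (key (Pi.single i0 1) (by simp) (by simp [Pi.single_apply, h0])).1
    · refine (key (b i1 • Pi.single i0 1 - b i0 • Pi.single i1 1) ?_ ?_).1
      · intro hz
        have := congrFun hz i1
        simp [hi, Ne.symm hi] at this
        exact h0 this
      · simp [Pi.single_apply, mul_sub, Finset.sum_sub_distrib]
        ring
  have hall : ∀ w : Vec n, ∑ i, c i * w i = 0 := by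
    intro w
    set v := w - ((∑ i, b i * w i) / s.bb) • s.bu with hv
    have hw : ∑ i, c i * v i = ∑ i, c i * w i := by
      have : ∑ i, c i * v i = ∑ i, c i * w i - (∑ i, b i * w i) / s.bb * ∑ i, c i * s.bu i := by
        rw [← hls, ← Finset.sum_sub_distrib]
        exact Finset.sum_congr rfl fun i _ => by rw [hv]; simp; ring
      rw [this, hc1]; ring
    rw [← hw]
    by_cases h0 : v = 0
    · rw [h0]; simp
    · refine (key v h0 ?_).2
      have : ∑ i, b i * v i = ∑ i, b i * w i - (∑ i, b i * w i) / s.bb * ∑ i, b i * s.bu i := by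
        rw [← hls, ← Finset.sum_sub_distrib]
        exact Finset.sum_congr rfl fun i _ => by rw [hv]; simp; ring
      rw [this, ← hBbu s.bu, hbb]
      field_simp
      ring
  funext i
  have := hall (Pi.single i 1)
  simpa [Pi.single_apply] using this

end curve

/-- **Theorem 1.2.** A conformally flat non-Riemannian Randers metric of weakly
isotropic scalar curvature must be (locally) Minkowskian: the conformal factor
`κ` is constant, so `F` does not depend on `x`. -/
theorem conformally_flat_randers_weakly_isotropic_is_minkowskian
    {n : ℕ} (hn : 2 ≤ n)
    (U : Set (Vec n)) (hUopen : IsOpen U) (hUconn : IsConnected U)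
    (a : Vec n → Matrix (Fin n) (Fin n) ℝ) (b : Vec n → Vec n)
    (hRanders : IsRandersOn a b U)
    (F : Vec n → Vec n → ℝ)
    (hFdef : ∀ x y, F x y = ralpha a x y + rbeta b x y)
    (hnonRiemannian : ∃ x ∈ U, b x ≠ 0)
    (κ : Vec n → ℝ) (hκ : ContDiffOn ℝ (⊤ : ℕ∞) κ U)
    (Fb : Vec n → ℝ) (hFb : IsMinkowskiNorm Fb)
    (hconfflat : ∀ x ∈ U, ∀ y : Vec n, y ≠ 0 → F x y = Real.exp (κ x) * Fb y)
    (θ : Vec n → Vec n) (μ : Vec n → ℝ)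
    (hθ : ContDiffOn ℝ (⊤ : ℕ∞) θ U) (hμ : ContDiffOn ℝ (⊤ : ℕ∞) μ U)
    (hwisc : ∀ x ∈ U, ∀ y : Vec n, y ≠ 0 →
      scalarCurv F x y =
        (n : ℝ) * ((n : ℝ) - 1) * ((∑ i, θ x i * y i) / F x y + μ x)) :
    (∀ x₁ ∈ U, ∀ x₂ ∈ U, κ x₁ = κ x₂) ∧
    (∀ x₁ ∈ U, ∀ x₂ ∈ U, ∀ y : Vec n, y ≠ 0 → F x₁ y = F x₂ y) := by

  obtain ⟨x0, hx0, hb0⟩ := hnonRiemannian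
  obtain ⟨-, -, hab, -, hFin⟩ := hRanders
  obtain ⟨hs, ha, hb1⟩ := hab x0 hx0
  have hpos : ∀ y : Vec n, y ≠ 0 →
      0 < Real.sqrt (∑ i, ∑ j, a x0 i j * y i * y j) + ∑ i, b x0 i * y i :=
    fun y hy => (hFin x0 hx0 y hy).1
  have hconst : ∀ x₁ ∈ U, ∀ x₂ ∈ U, κ x₁ = κ x₂ := by
    have hlinev : ∀ (c : Vec n) (y : Om n),
        evH y ((mkRD (a x0) hs ha (b x0) hpos).lin c) = ∑ i, c i * y.1 i := by
      intro c y
      simp only [RD.lin, map_sum, map_mul, AlgHom.commutes]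
      rfl
    have hFev : ∀ y : Om n, evH y (mkRD (a x0) hs ha (b x0) hpos).F = F x0 y.1 := by
      intro y
      rw [hFdef, RD.F, map_add]
      congr 1
      exact hlinev (b x0) y
    have hbb : (mkRD (a x0) hs ha (b x0) hpos).bb < 1 := by
      refine lt_of_eq_of_lt ?_ hb1
      simp only [RD.bb, RD.bu, bnormsq, Finset.sum_mul]
      refine Finset.sum_congr rfl fun i _ => Finset.sum_congr rfl fun j _ => ?_
      show (a x0)⁻¹ i j * b x0 j * b x0 i = _
      ring
    set s := mkRD (a x0) hs ha (b x0) hpos with hsd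
    have hkc : ContDiffOn ℝ (⊤ : ℕ∞) (fun x => κ x - κ x0) U := hκ.sub contDiffOn_const
    have hF : ∀ x ∈ U, ∀ y : Om n, F x y.1 = Real.exp (κ x - κ x0) * evH y s.F := by
      intro x hx y
      rw [hFev, hconfflat x hx y.1 y.2, hconfflat x0 hx0 y.1 y.2, ← mul_assoc, ← Real.exp_add]
      congr 2
      ring
    have hc : ∀ x ∈ U, (fun m => pd m (fun x => κ x - κ x0) x) = (0 : Vec n) := by
      intro x hx
      obtain ⟨r, hr, hmain⟩ := s.main_contr (fun m => pd m (fun x => κ x - κ x0) x)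
        (fun m j => pd j (pd m (fun x => κ x - κ x0)) x)
      have hn1 : (2 : ℝ) ≤ n := by exact_mod_cast hn
      refine c_zero (a x0) hs ha (b x0) hpos hn hb0 (K := 9 * ((n : ℝ) - 1))
        (by nlinarith) hbb
        (-r + algebraMap ℝ (SmR n) (2 * Real.exp (2 * (κ x - κ x0)) * (n * ((n : ℝ) - 1))) *
          (algebraMap ℝ (SmR n) (Real.exp (-(κ x - κ x0))) * s.lin (θ x) * s.F ^ 3
            + algebraMap ℝ (SmR n) (μ x) * s.F ^ 4))
        (add_mem (neg_mem hr) (mul_mem (s.hC _) (add_mem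
          (mul_mem (mul_mem (s.hC _) (s.hlin _)) (pow_mem s.hF 3))
          (mul_mem (s.hC _) (pow_mem s.hF 4))))) ?_
      intro y
      have h1 := pl_scal s rfl rfl hUopen hkc hF hx y
      rw [hmain, hwisc x hx y.1 y.2, hF x hx y, ← hlinev (θ x) y] at h1
      have hzf : evH y s.z * evH y s.F = 1 := by rw [← map_mul, s.zF, map_one]
      simp only [map_add, map_mul, map_neg, map_pow, map_sub, map_one, map_natCast, map_ofNat,
        AlgHom.commutes, Algebra.algebraMap_self, RingHom.id_apply] at h1 ⊢
      rw [← hsd]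
      generalize evH y s.z = z at *
      generalize evH y s.F = f at *
      generalize evH y s.Ap = A at *
      generalize evH y (s.lin (θ x)) = t at *
      generalize evH y (s.lin (fun m => pd m (fun x => κ x - κ x0) x)) = l at *
      generalize evH y r = ρ at *
      have hf0 : f ≠ 0 := right_ne_zero_of_mul_eq_one hzf
      have hz : z = f⁻¹ := eq_inv_of_mul_eq_one_left hzf
      subst hz
      rw [Real.exp_neg, show 2 * (κ x - κ x0) = (κ x - κ x0) + (κ x - κ x0) by ring,
        Real.exp_add] at h1
      rw [Real.exp_neg, show 2 * (κ x - κ x0) = (κ x - κ x0) + (κ x - κ x0) by ring,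
        Real.exp_add]
      have he := (Real.exp_pos (κ x - κ x0)).ne'
      generalize Real.exp (κ x - κ x0) = e at *
      field_simp at h1 ⊢
      linear_combination (-1/4) * h1
    intro x₁ h₁ x₂ h₂
    refine hUopen.is_const_of_fderiv_eq_zero (𝕜 := ℝ) hUconn.isPreconnected
      (hκ.differentiableOn (by simp)) ?_ h₁ h₂
    intro x hx
    have h0 := hc x hx
    ext v
    have hv : v = ∑ i, v i • (Pi.single i (1 : ℝ) : Vec n) := by
      simpa using pi_eq_sum_univ' v
    rw [hv, map_sum]
    refine Finset.sum_eq_zero fun i _ => ?_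
    have h3 : fderiv ℝ κ x (Pi.single i 1) = 0 := by
      have := congrFun h0 i
      simpa only [pd, fderiv_sub_const, Pi.zero_apply] using this
    rw [map_smul, h3, smul_zero]
  refine ⟨hconst, fun x₁ h₁ x₂ h₂ y hy => ?_⟩
  rw [hconfflat x₁ h₁ y hy, hconfflat x₂ h₂ y hy, hconst x₁ h₁ x₂ h₂]
end
end

section
/- Let n ≥ 2, let F : ℝⁿ \ {0} → (0,∞) be smooth with F(λy) = λF(y) for all λ > 0 and y ≠ 0, and suppose the matrix g_{ij}(y) := ½ ∂²(F²)/∂y^i∂y^j is invertible for every y ≠ 0, with inverse (g^{ij}(y)). Let ξ_1, …, ξ_n ∈ ℝ, set ξ(y) := ξ_i y^i, let μ ∈ ℝ, and define h(y) := (n−1)(3 ξ(y) F(y) + μ F(y)²). Then for every y ≠ 0: g^{ij}(y) · ½ ∂²h/∂y^i∂y^j (y) = n(n−1)( (3(n+1)/(2n)) · ξ(y)/F(y) + μ ). (Repeated indices are summed.) -/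
noncomputable section

lemma pd_mul' {n : ℕ} (i : Fin n) {f k : Vec n → ℝ} {x : Vec n}
    (hf : DifferentiableAt ℝ f x) (hk : DifferentiableAt ℝ k x) :
    pd i (fun z => f z * k z) x = f x * pd i k x + pd i f x * k x := by
  unfold pd
  rw [fderiv_fun_mul hf hk]
  simp [mul_comm]

lemma pd_add' {n : ℕ} (i : Fin n) {f k : Vec n → ℝ} {x : Vec n}
    (hf : DifferentiableAt ℝ f x) (hk : DifferentiableAt ℝ k x) :
    pd i (fun z => f z + k z) x = pd i f x + pd i k x := by
  unfold pd
  rw [fderiv_fun_add hf hk]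
  simp

lemma pd_const' {n : ℕ} (i : Fin n) (c : ℝ) (x : Vec n) :
    pd i (fun _ => c) x = 0 := by
  unfold pd
  simp

lemma pd_sum' {n : ℕ} (i : Fin n) {f : Fin n → Vec n → ℝ} {x : Vec n}
    (hf : ∀ j, DifferentiableAt ℝ (f j) x) :
    pd i (fun z => ∑ j, f j z) x = ∑ j, pd i (f j) x := by
  unfold pd
  rw [fderiv_fun_sum (fun j _ => hf j)]
  simp

lemma pd_coord' {n : ℕ} (i j : Fin n) (x : Vec n) :
    pd i (fun z => z j) x = if j = i then 1 else 0 := by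
  unfold pd
  have : HasFDerivAt (fun z : Vec n => z j) (ContinuousLinearMap.proj (R := ℝ) j) x :=
    (ContinuousLinearMap.proj (R := ℝ) (φ := fun _ : Fin n => ℝ) j).hasFDerivAt
  rw [this.fderiv]
  simp [Pi.single_apply]

lemma pd_lin' {n : ℕ} (i : Fin n) (ξ : Vec n) (x : Vec n) :
    pd i (fun z => ∑ j, ξ j * z j) x = ξ i := by
  rw [pd_sum' i (fun j => by fun_prop)]
  have : ∀ j, pd i (fun z : Vec n => ξ j * z j) x = if j = i then ξ j else 0 := by
    intro j
    rw [pd_mul' i (by fun_prop) (by fun_prop), pd_coord', pd_const']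
    simp
  simp [this]

lemma pd_congr' {n : ℕ} (i : Fin n) {f k : Vec n → ℝ} {x : Vec n} (hx : x ≠ 0)
    (hfk : ∀ z, z ≠ 0 → f z = k z) : pd i f x = pd i k x := by
  unfold pd
  have : f =ᶠ[nhds x] k := by
    filter_upwards [isOpen_ne.mem_nhds hx] with z hz using hfk z hz
  rw [this.fderiv_eq]

lemma trace_alg {n : ℕ} (G H : Matrix (Fin n) (Fin n) ℝ) (p y ξ : Vec n) (f X μ : ℝ)
    (hn : (n : ℝ) ≠ 0) (hf : f ≠ 0) (hG : IsUnit G)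
    (hGd : ∀ i j, G i j = p i * p j + f * H i j)
    (hs : ∀ i j, H i j = H j i)
    (hp : ∑ j, p j * y j = f) (hH : ∀ i, ∑ j, H i j * y j = 0)
    (hX : X = ∑ i, ξ i * y i) :
    ∑ i, ∑ j, G⁻¹ i j * ((1 / 2) * (((n : ℝ) - 1) *
      (3 * (ξ i * p j + ξ j * p i + X * H i j) + μ * (2 * G i j)))) =
      (n : ℝ) * ((n : ℝ) - 1) * ((3 * ((n : ℝ) + 1) / (2 * (n : ℝ))) * X / f + μ) := by
  have hdet := (Matrix.isUnit_iff_isUnit_det G).1 hG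
  have hGy : G.mulVec y = f • p := by
    ext i
    simp only [Matrix.mulVec, dotProduct, hGd, Pi.smul_apply, smul_eq_mul]
    calc _ = p i * ∑ j, p j * y j + f * ∑ j, H i j * y j := by
          rw [Finset.mul_sum, Finset.mul_sum, ← Finset.sum_add_distrib]
          exact Finset.sum_congr rfl fun j _ => by ring
      _ = _ := by rw [hp, hH]; ring
  have hGs : G.transpose = G := by
    ext i j
    rw [Matrix.transpose_apply, hGd, hGd, hs]; ring
  have hGis : ∀ i j, G⁻¹ i j = G⁻¹ j i := by
    intro i j
    have := Matrix.transpose_nonsing_inv G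
    rw [hGs] at this
    exact congrFun (congrFun this.symm i) j
  have hip : ∀ i, ∑ j, G⁻¹ i j * p j = y i / f := by
    intro i
    have h1 : G⁻¹.mulVec (G.mulVec y) = y := by
      rw [Matrix.mulVec_mulVec, Matrix.nonsing_inv_mul _ hdet, Matrix.one_mulVec]
    rw [hGy, Matrix.mulVec_smul] at h1
    have h2 := congrFun h1 i
    simp only [Pi.smul_apply, smul_eq_mul, Matrix.mulVec, dotProduct] at h2
    rw [← h2]; field_simp
  have hT : ∑ i, ∑ j, G⁻¹ i j * G i j = n := by
    have h1 : (G⁻¹ * G).trace = n := by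
      rw [Matrix.nonsing_inv_mul _ hdet]; simp
    rw [← h1]
    simp only [Matrix.trace, Matrix.diag, Matrix.mul_apply]
    refine Finset.sum_congr rfl fun i _ => Finset.sum_congr rfl fun j _ => ?_
    rw [hGd i j, hGd j i, hs i j]; ring
  have hA : ∑ i, ∑ j, G⁻¹ i j * (ξ i * p j) = X / f := by
    rw [hX, Finset.sum_div]
    refine Finset.sum_congr rfl fun i _ => ?_
    rw [mul_div_assoc, ← hip, Finset.mul_sum]
    exact Finset.sum_congr rfl fun j _ => by ring
  have hB : ∑ i, ∑ j, G⁻¹ i j * (ξ j * p i) = X / f := by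
    rw [← hA, Finset.sum_comm]
    refine Finset.sum_congr rfl fun i _ => Finset.sum_congr rfl fun j _ => ?_
    rw [hGis]
  have hC : ∑ i, ∑ j, G⁻¹ i j * (p i * p j) = 1 := by
    have : ∑ i, p i * y i / f = 1 := by rw [← Finset.sum_div, hp, div_self hf]
    rw [← this]
    refine Finset.sum_congr rfl fun i _ => ?_
    rw [mul_div_assoc, ← hip, Finset.mul_sum]
    exact Finset.sum_congr rfl fun j _ => by ring
  have key : ∀ i j, G⁻¹ i j * ((1 / 2) * (((n : ℝ) - 1) *
      (3 * (ξ i * p j + ξ j * p i + X * H i j) + μ * (2 * G i j)))) =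
      (3 / 2 * ((n : ℝ) - 1)) * (G⁻¹ i j * (ξ i * p j)) +
      (3 / 2 * ((n : ℝ) - 1)) * (G⁻¹ i j * (ξ j * p i)) +
      (3 / 2 * ((n : ℝ) - 1) * X / f + ((n : ℝ) - 1) * μ) * (G⁻¹ i j * G i j) -
      (3 / 2 * ((n : ℝ) - 1) * X / f) * (G⁻¹ i j * (p i * p j)) := by
    intro i j
    have : H i j = (G i j - p i * p j) / f := by rw [hGd]; field_simp; ring
    rw [this]; field_simp; ring
  simp only [key, Finset.sum_add_distrib, Finset.sum_sub_distrib, ← Finset.mul_sum, hA, hB, hC, hT]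
  field_simp
  ring

/-- **Pointwise computation underlying Lemma 2.1.** For a positively
1-homogeneous `F` with invertible fundamental tensor `g`, the `g`-trace of half
the Hessian of `h = (n−1)(3ξF + μF²)` equals
`n(n−1)((3(n+1)/(2n)) ξ/F + μ)`. -/
theorem g_trace_of_weak_einstein_expression
    {n : ℕ} (hn : 2 ≤ n)
    (F : Vec n → ℝ)
    (hFsmooth : ContDiffOn ℝ (⊤ : ℕ∞) F {y : Vec n | y ≠ 0})
    (hFpos : ∀ y : Vec n, y ≠ 0 → 0 < F y)
    (hFhom : ∀ y : Vec n, y ≠ 0 → ∀ t : ℝ, 0 < t → F (t • y) = t * F y)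
    (g : Vec n → Matrix (Fin n) (Fin n) ℝ)
    (hg : ∀ y : Vec n, g y =
      Matrix.of fun i j => (1 / 2) * pd i (fun y' => pd j (fun z => (F z) ^ 2) y') y)
    (hginv : ∀ y : Vec n, y ≠ 0 → IsUnit (g y))
    (ξ : Vec n) (μ : ℝ)
    (h : Vec n → ℝ)
    (hh : ∀ y : Vec n, h y =
      ((n : ℝ) - 1) * (3 * (∑ i, ξ i * y i) * F y + μ * (F y) ^ 2)) :
    ∀ y : Vec n, y ≠ 0 →
      (∑ i, ∑ j, (g y)⁻¹ i j * ((1 / 2) * pd i (fun y' => pd j h y') y)) =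
        (n : ℝ) * ((n : ℝ) - 1) *
          ((3 * ((n : ℝ) + 1) / (2 * (n : ℝ))) * (∑ i, ξ i * y i) / F y + μ) := by
  have htop : (2 : WithTop ℕ∞) ≤ ((⊤ : ℕ∞) : WithTop ℕ∞) :=
    WithTop.coe_le_coe.2 (le_top : (2 : ℕ∞) ≤ ⊤)
  have hcd : ∀ z : Vec n, z ≠ 0 → ContDiffAt ℝ (⊤ : ℕ∞) F z := fun z hz =>
    hFsmooth.contDiffAt (isOpen_ne.mem_nhds hz)
  have hFd : ∀ z : Vec n, z ≠ 0 → DifferentiableAt ℝ F z := fun z hz =>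
    (hcd z hz).differentiableAt (by simp)
  have hfd : ∀ z : Vec n, z ≠ 0 → DifferentiableAt ℝ (fderiv ℝ F) z := fun z hz =>
    ((hcd z hz).fderiv_right (m := 1) (by rw [one_add_one_eq_two]; exact htop)).differentiableAt (by simp)
  have hpd : ∀ j, ∀ z : Vec n, z ≠ 0 → DifferentiableAt ℝ (pd j F) z := fun j z hz =>
    (hfd z hz).clm_apply (differentiableAt_const _)
  have hsymm : ∀ z : Vec n, z ≠ 0 → ∀ i j, pd i (pd j F) z = pd j (pd i F) z := by
    intro z hz i j
    have e : ∀ i j, pd i (pd j F) z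
        = fderiv ℝ (fderiv ℝ F) z (Pi.single i 1) (Pi.single j 1) := by
      intro i j
      unfold pd
      rw [fderiv_clm_apply (hfd z hz) (differentiableAt_const _)]
      simp
    rw [e, e]
    exact ((hcd z hz).isSymmSndFDerivAt (by simpa using htop)) _ _
  have heuler : ∀ z : Vec n, z ≠ 0 → ∑ j, pd j F z * z j = F z := by
    intro z hz
    have h1 : fderiv ℝ F z z = ∑ j, pd j F z * z j := by
      have h0 := congrArg (fderiv ℝ F z) (pi_eq_sum_univ' z)
      rw [h0]
      simp [pd, mul_comm]
    rw [← h1]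
    have hc : HasDerivAt (fun t : ℝ => t • z) z 1 := by
      simpa using (hasDerivAt_id (1 : ℝ)).smul_const z
    have hF1 : HasFDerivAt F (fderiv ℝ F z) ((1 : ℝ) • z) := by
      rw [one_smul]; exact (hFd z hz).hasFDerivAt
    have h2 := hF1.comp_hasDerivAt (1 : ℝ) hc
    have h3 : HasDerivAt (fun t : ℝ => t * F z) (F z) 1 := by
      simpa using (hasDerivAt_id (1 : ℝ)).mul_const (F z)
    have h4 : (F ∘ fun t : ℝ => t • z) =ᶠ[nhds 1] fun t : ℝ => t * F z := by
      filter_upwards [lt_mem_nhds (zero_lt_one' ℝ)] with t ht using hFhom z hz t ht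
    exact (h2.congr_of_eventuallyEq h4.symm).unique h3
  intro y hy
  have hH : ∀ i, ∑ j, pd i (pd j F) y * y j = 0 := by
    intro i
    have h1 := pd_congr' i hy heuler
    rw [pd_sum' i (fun j => (hpd j y hy).fun_mul (by fun_prop))] at h1
    have h2 : ∀ j, pd i (fun z => pd j F z * z j) y
        = (if j = i then pd j F y else 0) + pd i (pd j F) y * y j := by
      intro j
      rw [pd_mul' i (hpd j y hy) (by fun_prop), pd_coord']
      simp
    simp only [h2, Finset.sum_add_distrib] at h1
    simpa using h1
  have hsq1 : ∀ j, ∀ z : Vec n, z ≠ 0 → pd j (fun z => (F z) ^ 2) z = 2 * (F z * pd j F z) := by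
    intro j z hz
    simp only [pow_two]
    rw [pd_mul' j (hFd z hz) (hFd z hz)]; ring
  have hsq2 : ∀ i j, pd i (fun y' => pd j (fun z => (F z) ^ 2) y') y
      = 2 * (pd i F y * pd j F y + F y * pd i (pd j F) y) := by
    intro i j
    rw [pd_congr' i hy (hsq1 j), pd_mul' i (by fun_prop) ((hFd y hy).fun_mul (hpd j y hy)),
      pd_mul' i (hFd y hy) (hpd j y hy), pd_const']
    ring
  have hGd : ∀ i j, g y i j = pd i F y * pd j F y + F y * pd i (pd j F) y := by
    intro i j
    rw [hg, Matrix.of_apply, hsq2]; ring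
  have hh1 : ∀ j, ∀ z : Vec n, z ≠ 0 → pd j h z = ((n : ℝ) - 1) *
      (3 * ((∑ i, ξ i * z i) * pd j F z + ξ j * F z) + μ * pd j (fun z => (F z) ^ 2) z) := by
    intro j z hz
    have d := hFd z hz
    have : h = fun y => ((n : ℝ) - 1) * (3 * ((∑ i, ξ i * y i) * F y) + μ * (F y) ^ 2) := by
      funext y; rw [hh]; ring
    rw [this, pd_mul' j (by fun_prop) (by fun_prop), pd_add' j (by fun_prop) (by fun_prop),
      pd_mul' j (by fun_prop) (by fun_prop), pd_mul' j (by fun_prop) (by fun_prop),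
      pd_mul' j (by fun_prop) (by fun_prop), pd_lin', pd_const', pd_const', pd_const']
    ring
  have hh2 : ∀ i j, pd i (fun y' => pd j h y') y = ((n : ℝ) - 1) *
      (3 * (ξ i * pd j F y + ξ j * pd i F y + (∑ i, ξ i * y i) * pd i (pd j F) y)
        + μ * (2 * g y i j)) := by
    intro i j
    have d := hFd y hy
    have d1 := hpd j y hy
    have d2 : DifferentiableAt ℝ (pd j (fun z => (F z) ^ 2)) y := by
      have : DifferentiableAt ℝ (fun z => 2 * (F z * pd j F z)) y := by fun_prop
      refine this.congr_of_eventuallyEq ?_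
      filter_upwards [isOpen_ne.mem_nhds hy] with z hz using hsq1 j z hz
    rw [pd_congr' i hy (hh1 j), pd_mul' i (by fun_prop) (by fun_prop),
      pd_add' i (by fun_prop) (by fun_prop),
      pd_mul' i (by fun_prop) (by fun_prop), pd_add' i (by fun_prop) (by fun_prop),
      pd_mul' i (by fun_prop) (by fun_prop), pd_mul' i (by fun_prop) (by fun_prop),
      pd_mul' i (by fun_prop) (by fun_prop), pd_lin', pd_const', pd_const', pd_const', pd_const',
      hsq2, hGd]
    ring
  simp only [hh2]
  exact trace_alg (g y) (Matrix.of fun i j => pd i (pd j F) y) (fun i => pd i F y) y ξ (F y) _ μ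
    (by positivity) (hFpos y hy).ne' (hginv y hy) hGd (hsymm y hy) (heuler y hy) hH rfl
end
end
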